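/- arXiv:2505.16551 — 2 statements merged into one kernel-verified Lean document; each statement's English description precedes it below -/
import Mathlib

section
/- For every database D and finite rule set Σ, there is a run of the non-deterministic machine M_Σ on the encoding of D that visits the designated state q_r infinitely often if and only if there is a non-terminating (infinite, fair) restricted chase sequence for the knowledge base ⟨Σ, D⟩. -/
/-!
Common formalization framework for "Restricted Chase Termination: You Want More than Fairness"
(Carral, Gerlach, Larroque, Thomazo).

Syntax is encoded over natural numbers so that all finite objects (rules, databases, knowledge
bases, Turing machines) live in `Primcodable` types, which allows us to speak about
many-one reductions and about the arithmetical/analytical hierarchy.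
-/

namespace ChaseTermination

/-! ### Terms, atoms, facts, rules, knowledge bases -/

/-- Ground terms: `Sum.inl c` is the constant `c`, `Sum.inr n` is the null `n`. -/
abbrev GroundTerm : Type := ℕ ⊕ ℕ

/-- Terms of rules: `Sum.inl v` is the variable `v`, `Sum.inr g` a ground term. -/
abbrev RTerm : Type := ℕ ⊕ GroundTerm

/-- A fact: a predicate (coded by a natural number) applied to ground terms. -/
abbrev Fact : Type := ℕ × List GroundTerm

/-- An atom: a predicate applied to terms. -/
abbrev Atom : Type := ℕ × List RTerm

/-- An existential rule, given by its body and its head (lists of atoms);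
the universally quantified variables are those occurring in the body, the existentially
quantified ones are the head variables not occurring in the body. -/
abbrev Rule : Type := List Atom × List Atom

abbrev RuleSet : Type := List Rule

abbrev Database : Type := List Fact

/-- A knowledge base: a (finite) rule set together with a database. -/
abbrev KB : Type := RuleSet × Database

def atomHasVar (a : Atom) (v : ℕ) : Prop := (Sum.inl v : RTerm) ∈ a.2

def atomNullFree (a : Atom) : Prop := ∀ t ∈ a.2, ∀ n : ℕ, t ≠ Sum.inr (Sum.inr n)

def factNullFree (f : Fact) : Prop := ∀ t ∈ f.2, ∀ n : ℕ, t ≠ Sum.inr n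

/-- A database is a finite fact set without nulls. -/
def IsDatabase (D : Database) : Prop := ∀ f ∈ D, factNullFree f

/-- Well-formed rule: non-empty head, no nulls. -/
def IsRule (r : Rule) : Prop := r.2 ≠ [] ∧ ∀ a ∈ r.1 ++ r.2, atomNullFree a

def IsRuleSet (S : RuleSet) : Prop := ∀ r ∈ S, IsRule r

def IsKB (kb : KB) : Prop := IsRuleSet kb.1 ∧ IsDatabase kb.2

/-- `v` occurs in the body of `r` (i.e. is universally quantified). -/
def bodyVar (r : Rule) (v : ℕ) : Prop := ∃ a ∈ r.1, atomHasVar a v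

/-- `v` is an existential variable of `r`. -/
def existVar (r : Rule) (v : ℕ) : Prop := (∃ a ∈ r.2, atomHasVar a v) ∧ ¬ bodyVar r v

def applyT (σ : ℕ → GroundTerm) : RTerm → GroundTerm
  | Sum.inl v => σ v
  | Sum.inr g => g

def applyA (σ : ℕ → GroundTerm) (a : Atom) : Fact := (a.1, a.2.map (applyT σ))

/-- A trigger: a rule together with a substitution for its (universal) variables. -/
abbrev Trigger : Type := Rule × (ℕ → GroundTerm)

/-- The support of a trigger: the instantiated body. -/
def support (t : Trigger) : Set Fact := {f | ∃ a ∈ t.1.1, f = applyA t.2 a}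

/-- A trigger is loaded for `F` if `F` includes its support. -/
def loaded (t : Trigger) (F : Set Fact) : Prop := ∀ a ∈ t.1.1, applyA t.2 a ∈ F

/-- `σ'` agrees with the substitution of `t` on all universally quantified (body) variables. -/
def agreesOnBody (t : Trigger) (σ' : ℕ → GroundTerm) : Prop :=
  ∀ v, bodyVar t.1 v → σ' v = t.2 v

/-- A trigger is obsolete for `F` if some extension of its substitution to the existential
variables sends the head into `F`. -/
def obsolete (t : Trigger) (F : Set Fact) : Prop :=
  ∃ σ' : ℕ → GroundTerm, agreesOnBody t σ' ∧ ∀ a ∈ t.1.2, applyA σ' a ∈ F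

/-- The (ground) terms occurring in a fact set. -/
def termsOf (F : Set Fact) : Set GroundTerm := {g | ∃ f ∈ F, g ∈ f.2}

/-- `σ'` is a proper output extension of the trigger `t` w.r.t. `F`: it agrees with the trigger
substitution on body variables and maps existential variables to pairwise distinct fresh nulls. -/
def properExt (t : Trigger) (F : Set Fact) (σ' : ℕ → GroundTerm) : Prop :=
  agreesOnBody t σ' ∧
  (∀ v, existVar t.1 v → ∃ n : ℕ, σ' v = Sum.inr n ∧ (Sum.inr n : GroundTerm) ∉ termsOf F) ∧
  (∀ v w, existVar t.1 v → existVar t.1 w → σ' v = σ' w → v = w)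

/-- The output of a trigger under an extended substitution. -/
def outputOf (t : Trigger) (σ' : ℕ → GroundTerm) : Set Fact := {f | ∃ a ∈ t.1.2, f = applyA σ' a}

/-- An active trigger of `S` for `F`: loaded and not obsolete. -/
def Active (S : RuleSet) (F : Set Fact) (t : Trigger) : Prop :=
  t.1 ∈ S ∧ loaded t F ∧ ¬ obsolete t F

/-- One restricted chase step. -/
def ChaseStep (S : RuleSet) (F F' : Set Fact) : Prop :=
  ∃ t : Trigger, Active S F t ∧ ∃ σ', properExt t F σ' ∧ F' = F ∪ outputOf t σ'

def dbSet (D : Database) : Set Fact := {f | f ∈ D}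

/-- A (possibly infinite) restricted chase derivation for `⟨S, D⟩`, of length `len ∈ ℕ∞`.
Beyond the length the fact sets stall, so that the result is always `⋃ i, fact i`. -/
structure Chase (S : RuleSet) (D : Set Fact) where
  len : ℕ∞
  fact : ℕ → Set Fact
  trig : ℕ → Trigger
  ext : ℕ → ℕ → GroundTerm
  init : fact 0 = D
  activeAt : ∀ i : ℕ, (i : ℕ∞) < len → Active S (fact i) (trig i)
  extOk : ∀ i : ℕ, (i : ℕ∞) < len → properExt (trig i) (fact i) (ext i)
  succ : ∀ i : ℕ, (i : ℕ∞) < len → fact (i + 1) = fact i ∪ outputOf (trig i) (ext i)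
  stall : ∀ i : ℕ, ¬ ((i : ℕ∞) < len) → fact (i + 1) = fact i

/-- Fairness: every trigger that becomes loaded is eventually obsolete.
A fair chase derivation is a *restricted chase sequence*; note that for a finite derivation
fairness forces maximality (no active trigger remains at the end). -/
def Fair {S : RuleSet} {D : Set Fact} (c : Chase S D) : Prop :=
  ∀ t : Trigger, t.1 ∈ S → ∀ i : ℕ, loaded t (c.fact i) → ∃ j : ℕ, i ≤ j ∧ obsolete t (c.fact j)

/-- The result of a chase derivation. -/
def chaseResult {S : RuleSet} {D : Set Fact} (c : Chase S D) : Set Fact := ⋃ i, c.fact i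

/-- The derivation is infinite (non-terminating). -/
def IsInfinite {S : RuleSet} {D : Set Fact} (c : Chase S D) : Prop := c.len = ⊤

/-- `TKR∀`: knowledge bases all of whose restricted chase sequences are finite. -/
def TKRall (kb : KB) : Prop :=
  IsKB kb ∧ ¬ ∃ c : Chase kb.1 (dbSet kb.2), IsInfinite c ∧ Fair c

/-- `TRR∀`: rule sets universally terminating for the restricted chase on every database. -/
def TRRall (S : RuleSet) : Prop :=
  IsRuleSet S ∧ ∀ D : Database, IsDatabase D → ¬ ∃ c : Chase S (dbSet D), IsInfinite c ∧ Fair c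

/-! ### Breadth-first chase -/

/-- The instance of a trigger: its rule together with its instantiated body (this determines the
substitution on all body variables). -/
def instOf (t : Trigger) : Rule × List Fact := (t.1, t.1.1.map (applyA t.2))

/-- The set of instances of active triggers (this is what "the number of triggers that are loaded
and not obsolete" counts). -/
def activeInsts (S : RuleSet) (F : Set Fact) : Set (Rule × List Fact) :=
  {p | ∃ t : Trigger, Active S F t ∧ p = instOf t}

/-- The breadth-first condition (†): a trigger loaded at step `i` becomes obsolete within the
next `n` steps, where `n` is the number of active triggers at step `i`. -/
def BreadthFirst {S : RuleSet} {D : Set Fact} (c : Chase S D) : Prop :=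
  ∀ i : ℕ, ∀ t : Trigger, t.1 ∈ S → loaded t (c.fact i) →
    ∃ j : ℕ, i ≤ j ∧ j ≤ i + (activeInsts S (c.fact i)).ncard ∧ obsolete t (c.fact j)

/-- `TKRBF∀`: knowledge bases all of whose breadth-first chase sequences are finite. -/
def TKRBFall (kb : KB) : Prop :=
  IsKB kb ∧ ¬ ∃ c : Chase kb.1 (dbSet kb.2), IsInfinite c ∧ BreadthFirst c

/-- `TRRBF∀`: rule sets whose breadth-first chase terminates on every database. -/
def TRRBFall (S : RuleSet) : Prop :=
  IsRuleSet S ∧ ∀ D : Database, IsDatabase D →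
    ¬ ∃ c : Chase S (dbSet D), IsInfinite c ∧ BreadthFirst c

/-! ### Classes of the arithmetical and analytical hierarchies -/

/-- `Π⁰₂` predicates, via the Kleene normal form `∀ m ∃ k. R`. -/
def Pi02 {α : Type} [Primcodable α] (p : α → Prop) : Prop :=
  ∃ R : α × ℕ → ℕ → Bool, Computable₂ R ∧ ∀ a, p a ↔ ∀ m : ℕ, ∃ k : ℕ, R (a, m) k = true

/-- `Π¹₁` predicates, via the Kleene normal form: `p a` iff for every function `f : ℕ → ℕ` some
finite initial segment of `f` witnesses a computable predicate. -/
def Pi11 {α : Type} [Primcodable α] (p : α → Prop) : Prop :=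
  ∃ R : α → List ℕ → Bool, Computable₂ R ∧
    ∀ a, p a ↔ ∀ f : ℕ → ℕ, ∃ k : ℕ, R a ((List.range k).map f) = true

/-- `Π¹₁`-hardness: every `Π¹₁` problem many-one reduces to `p`. -/
def Pi11Hard {α : Type} [Primcodable α] (p : α → Prop) : Prop :=
  ∀ q : ℕ → Prop, Pi11 q → q ≤₀ p

def Pi11Complete {α : Type} [Primcodable α] (p : α → Prop) : Prop := Pi11 p ∧ Pi11Hard p

/-! ### Non-deterministic Turing machines -/

/-- A non-deterministic Turing machine `(numStates, alphaSize, table)`.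
States are `0, …, numStates - 1` with initial state `0`; tape symbols `0, …, alphaSize - 1`
form `Γ` (so `{0,1} ⊆ Γ` iff `2 ≤ alphaSize`), and the blank `B` is coded by `alphaSize`.
An entry `((q, a), (q', b, d))` means `(q', b, d) ∈ δ(q, a)`, with `d = true` for a right move
and `d = false` for a left move. -/
abbrev NTM : Type := ℕ × ℕ × List ((ℕ × ℕ) × (ℕ × ℕ × Bool))

def NTM.numStates (M : NTM) : ℕ := M.1
def NTM.blank (M : NTM) : ℕ := M.2.1
def NTM.table (M : NTM) : List ((ℕ × ℕ) × (ℕ × ℕ × Bool)) := M.2.2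

/-- Well-formedness: `Γ ⊇ {0,1}`, transitions use valid states and symbols, and the machine
never writes the blank. -/
def NTM.WF (M : NTM) : Prop :=
  1 ≤ NTM.numStates M ∧ 2 ≤ NTM.blank M ∧
    ∀ e ∈ NTM.table M, e.1.1 < NTM.numStates M ∧ e.1.2 ≤ NTM.blank M ∧
      e.2.1 < NTM.numStates M ∧ e.2.2.1 < NTM.blank M

/-- A configuration `(tape, p, q)`: tape contents (a list of symbol codes whose last cell is
blank and in which no proper symbol occurs after a blank), 0-based head position `p`,
and current state `q`. -/
abbrev Config : Type := List ℕ × ℕ × ℕ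

def WFConfig (M : NTM) (ρ : Config) : Prop :=
  ρ.2.1 < ρ.1.length ∧ ρ.1.getLast? = some (NTM.blank M) ∧
    (∀ i j : ℕ, i ≤ j → j < ρ.1.length → ρ.1.getD i 0 = NTM.blank M →
      ρ.1.getD j 0 = NTM.blank M) ∧
    (∀ a ∈ ρ.1, a ≤ NTM.blank M) ∧ ρ.2.2 < NTM.numStates M

/-- The one-step relation `Next_M` between configurations; each step extends the represented
part of the tape by one blank cell. -/
def NTM.Next (M : NTM) (ρ ρ' : Config) : Prop :=
  ∃ q' b : ℕ, ∃ d : Bool,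
    ((ρ.2.2, ρ.1.getD ρ.2.1 0), (q', b, d)) ∈ NTM.table M ∧
    (d = true ∨ 1 ≤ ρ.2.1) ∧
    ρ' = (ρ.1.set ρ.2.1 b ++ [NTM.blank M], if d then ρ.2.1 + 1 else ρ.2.1 - 1, q')

/-- The starting configuration of `M` on a word. -/
def startConfig (M : NTM) (w : List ℕ) : Config := (w ++ [NTM.blank M], 0, 0)

/-- Words are over the input alphabet `{0, 1}`. -/
def IsWord (w : List ℕ) : Prop := ∀ a ∈ w, a < 2

/-- There is a run of `M` starting in `ρ` that visits the state `qr` infinitely often.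
(Such a run is necessarily infinite, and every infinite sequence of `Next_M`-successive
configurations is a run; finite runs trivially feature `qr` only finitely many times.) -/
def RecurringFrom (M : NTM) (qr : ℕ) (ρ : Config) : Prop :=
  ∃ c : ℕ → Config, c 0 = ρ ∧ (∀ i, NTM.Next M (c i) (c (i + 1))) ∧
    ∀ N : ℕ, ∃ i : ℕ, N ≤ i ∧ (c i).2.2 = qr

/-- `M` is non-recurring through `qr` on the configuration `ρ`: every run of `M` on `ρ`
features `qr` only finitely many times. -/
def NonRecurringFrom (M : NTM) (qr : ℕ) (ρ : Config) : Prop := ¬ RecurringFrom M qr ρ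

end ChaseTermination
namespace ChaseTermination

/-! ### The rule set `Σ_M` of Section 4 and the databases `D_ρ` -/

/-- Predicate codes. `pF`, `pR` are the ternary time/tape successor predicates. -/
def pF : ℕ := 0
def pR : ℕ := 1
def pCL : ℕ := 2
def pCR : ℕ := 3
def pReal : ℕ := 4
def pBrake : ℕ := 5
def pNextBr : ℕ := 6
def pEnd : ℕ := 7
/-- The binary letter predicate for the tape symbol `a`. -/
def pLetter (a : ℕ) : ℕ := 8 + 2 * a
/-- The binary state predicate for the state `q`. -/
def pState (q : ℕ) : ℕ := 9 + 2 * q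

/-- Variable codes used in the rules: `x, y, x', y', w, w'` are `0, …, 5`. -/
def tv (v : ℕ) : RTerm := Sum.inl v

def A1 (p : ℕ) (s : RTerm) : Atom := (p, [s])
def A2 (p : ℕ) (s t : RTerm) : Atom := (p, [s, t])
def A3 (p : ℕ) (s t u : RTerm) : Atom := (p, [s, t, u])

/-- `brSet(x, w)` as atoms: `{F(x,w,w), R(x,w,w), Real(x), Brake(w)}`. -/
def brSetA (x w : RTerm) : List Atom := [A3 pF x w w, A3 pR x w w, A1 pReal x, A1 pBrake w]

/-- Tape alphabet including the blank: `Γ ∪ {B}`. -/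
def letters (M : NTM) : List ℕ := List.range (NTM.blank M + 1)
def states (M : NTM) : List ℕ := List.range (NTM.numStates M)

/-- The rule `R_Brake`. -/
def ruleBrake (M : NTM) : Rule :=
  ([A1 pBrake (tv 4)],
    ((letters M).map fun a => A2 (pLetter a) (tv 4) (tv 4)) ++
    ((states M).map fun q => A2 (pState q) (tv 4) (tv 4)) ++
    [A3 pF (tv 4) (tv 4) (tv 4), A3 pR (tv 4) (tv 4) (tv 4),
     A2 pCL (tv 4) (tv 4), A2 pCR (tv 4) (tv 4), A1 pReal (tv 4), A2 pNextBr (tv 4) (tv 4)])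

/-- The rule `R_nextBr`. -/
def ruleNextBr : Rule :=
  (brSetA (tv 0) (tv 4) ++ [A2 pNextBr (tv 4) (tv 5)], brSetA (tv 0) (tv 5))

/-- Transition rule for `(q', b, →) ∈ δ(q, a)` and the letter `c`; if `q = qr` a fresh
brake `w'` is created together with a `nextBr`-atom, otherwise the brake `w` is reused. -/
def mkTransRight (qr q a q' b c : ℕ) : Rule :=
  ([A2 (pState q) (tv 0) (tv 4), A2 (pLetter a) (tv 0) (tv 4), A3 pR (tv 0) (tv 1) (tv 4),
    A2 (pLetter c) (tv 1) (tv 4)] ++ brSetA (tv 0) (tv 4) ++ brSetA (tv 1) (tv 4),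
   if q = qr then
     [A2 (pState q') (tv 3) (tv 5), A2 (pLetter c) (tv 3) (tv 5), A2 (pLetter b) (tv 2) (tv 5),
      A3 pR (tv 2) (tv 3) (tv 5), A3 pF (tv 0) (tv 2) (tv 5), A3 pF (tv 1) (tv 3) (tv 5),
      A2 pCL (tv 2) (tv 5), A2 pCR (tv 3) (tv 5)] ++
      brSetA (tv 2) (tv 5) ++ brSetA (tv 3) (tv 5) ++ [A2 pNextBr (tv 4) (tv 5)]
   else
     [A2 (pState q') (tv 3) (tv 4), A2 (pLetter c) (tv 3) (tv 4), A2 (pLetter b) (tv 2) (tv 4),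
      A3 pR (tv 2) (tv 3) (tv 4), A3 pF (tv 0) (tv 2) (tv 4), A3 pF (tv 1) (tv 3) (tv 4),
      A2 pCL (tv 2) (tv 4), A2 pCR (tv 3) (tv 4)] ++ brSetA (tv 2) (tv 4) ++ brSetA (tv 3) (tv 4))

/-- Transition rule for `(q', b, ←) ∈ δ(q, a)` and the letter `c`. -/
def mkTransLeft (qr q a q' b c : ℕ) : Rule :=
  ([A2 (pState q) (tv 0) (tv 4), A2 (pLetter a) (tv 0) (tv 4), A3 pR (tv 1) (tv 0) (tv 4),
    A2 (pLetter c) (tv 1) (tv 4)] ++ brSetA (tv 0) (tv 4) ++ brSetA (tv 1) (tv 4),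
   if q = qr then
     [A2 (pState q') (tv 3) (tv 5), A2 (pLetter c) (tv 3) (tv 5), A2 (pLetter b) (tv 2) (tv 5),
      A3 pR (tv 3) (tv 2) (tv 5), A3 pF (tv 0) (tv 2) (tv 5), A3 pF (tv 1) (tv 3) (tv 5),
      A2 pCL (tv 3) (tv 5), A2 pCR (tv 2) (tv 5)] ++
      brSetA (tv 2) (tv 5) ++ brSetA (tv 3) (tv 5) ++ [A2 pNextBr (tv 4) (tv 5)]
   else
     [A2 (pState q') (tv 3) (tv 4), A2 (pLetter c) (tv 3) (tv 4), A2 (pLetter b) (tv 2) (tv 4),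
      A3 pR (tv 3) (tv 2) (tv 4), A3 pF (tv 0) (tv 2) (tv 4), A3 pF (tv 1) (tv 3) (tv 4),
      A2 pCL (tv 3) (tv 4), A2 pCR (tv 2) (tv 4)] ++ brSetA (tv 2) (tv 4) ++ brSetA (tv 3) (tv 4))

/-- All transition rules of `Σ_M` (one per table entry and letter `c`). -/
def transRules (M : NTM) (qr : ℕ) : List Rule :=
  (NTM.table M).foldr (fun e acc =>
    ((letters M).map fun cc =>
      if e.2.2.2 = true then mkTransRight qr e.1.1 e.1.2 e.2.1 e.2.2.1 cc
      else mkTransLeft qr e.1.1 e.1.2 e.2.1 e.2.2.1 cc) ++ acc) []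

/-- The rule `R_{C_R}` for the letter `a`. -/
def mkCopyRight (a : ℕ) : Rule :=
  ([A2 pCR (tv 2) (tv 5), A3 pF (tv 0) (tv 2) (tv 5), A3 pR (tv 0) (tv 1) (tv 4),
    A2 (pLetter a) (tv 1) (tv 4)] ++
    brSetA (tv 0) (tv 4) ++ brSetA (tv 2) (tv 5) ++ brSetA (tv 1) (tv 4),
   [A3 pF (tv 1) (tv 3) (tv 5), A3 pR (tv 2) (tv 3) (tv 5), A2 (pLetter a) (tv 3) (tv 5),
    A2 pCR (tv 3) (tv 5)] ++ brSetA (tv 3) (tv 5))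

/-- The rule `R_{C_L}` for the letter `a`. -/
def mkCopyLeft (a : ℕ) : Rule :=
  ([A2 pCL (tv 2) (tv 5), A3 pF (tv 0) (tv 2) (tv 5), A3 pR (tv 1) (tv 0) (tv 4),
    A2 (pLetter a) (tv 1) (tv 4)] ++
    brSetA (tv 0) (tv 4) ++ brSetA (tv 2) (tv 5) ++ brSetA (tv 1) (tv 4),
   [A3 pF (tv 1) (tv 3) (tv 5), A3 pR (tv 3) (tv 2) (tv 5), A2 (pLetter a) (tv 3) (tv 5),
    A2 pCL (tv 3) (tv 5)] ++ brSetA (tv 3) (tv 5))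

def copyRightRules (M : NTM) : List Rule := (letters M).map mkCopyRight
def copyLeftRules (M : NTM) : List Rule := (letters M).map mkCopyLeft

/-- The tape-extension rule `R_End`. -/
def ruleEnd (M : NTM) : Rule :=
  ([A2 pCR (tv 2) (tv 5), A3 pF (tv 0) (tv 2) (tv 5), A2 pEnd (tv 0) (tv 4)] ++
    brSetA (tv 0) (tv 4) ++ brSetA (tv 2) (tv 5),
   [A3 pR (tv 2) (tv 3) (tv 5), A2 (pLetter (NTM.blank M)) (tv 3) (tv 5),
    A2 pEnd (tv 3) (tv 5)] ++ brSetA (tv 3) (tv 5))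

/-- The rule set `Σ_M` of Section 4 (simulating `M`, with the designated state `qr`). -/
def SigmaM (M : NTM) (qr : ℕ) : RuleSet :=
  [ruleBrake M, ruleNextBr] ++ transRules M qr ++
    copyLeftRules M ++ copyRightRules M ++ [ruleEnd M]

/-- The constant `c_i` (0-based). -/
def cst (i : ℕ) : GroundTerm := Sum.inl (i + 1)
/-- The brake constant `w₁` of the database. -/
def w1 : GroundTerm := Sum.inl 0

/-- `brSet(x, w)` as facts. -/
def brSetF (x w : GroundTerm) : List Fact :=
  [(pF, [x, w, w]), (pR, [x, w, w]), (pReal, [x]), (pBrake, [w])]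

/-- The database `D_ρ` encoding a configuration `ρ`. -/
def Drho (M : NTM) (ρ : Config) : Database :=
  ((List.range ρ.1.length).map fun i => ((pR, [cst i, cst (i + 1), w1]) : Fact)) ++
  ((List.range ρ.1.length).map fun i => ((pLetter (ρ.1.getD i 0), [cst i, w1]) : Fact)) ++
  [((pState ρ.2.2, [cst ρ.2.1, w1]) : Fact),
   ((pLetter (NTM.blank M), [cst ρ.1.length, w1]) : Fact),
   ((pEnd, [cst ρ.1.length, w1]) : Fact)] ++
  (List.range (ρ.1.length + 1)).foldr (fun i acc => brSetF (cst i) w1 ++ acc) []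

/-! ### Wild frontiers -/

/-- The atoms explicitly required by the wild-frontier condition ("other" atoms are those
not in this set). -/
def wfListed (M : NTM) (ρ : Config) (w : GroundTerm) (x : ℕ → GroundTerm) : Set Fact :=
  {f | (∃ i < ρ.1.length,
          f = ((pR, [x i, x (i + 1), w]) : Fact) ∨
          f = ((pLetter (ρ.1.getD i 0), [x i, w]) : Fact)) ∨
    f = ((pState ρ.2.2, [x ρ.2.1, w]) : Fact) ∨
    f = ((pEnd, [x ρ.1.length, w]) : Fact) ∨
    f = ((pLetter (NTM.blank M), [x ρ.1.length, w]) : Fact) ∨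
    (∃ i ≤ ρ.1.length, f ∈ brSetF (x i) w)}

/-- `F` has a wild frontier of the configuration `ρ` overseen by `w` (Definition 4.4). -/
def WildFrontier (M : NTM) (F : Set Fact) (ρ : Config) (w : GroundTerm) : Prop :=
  ∃ x : ℕ → GroundTerm,
    ((pReal, [w]) : Fact) ∉ F ∧
    (∀ i < ρ.1.length, ((pR, [x i, x (i + 1), w]) : Fact) ∈ F ∧
      ((pLetter (ρ.1.getD i 0), [x i, w]) : Fact) ∈ F) ∧
    ((pState ρ.2.2, [x ρ.2.1, w]) : Fact) ∈ F ∧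
    ((pEnd, [x ρ.1.length, w]) : Fact) ∈ F ∧
    ((pLetter (NTM.blank M), [x ρ.1.length, w]) : Fact) ∈ F ∧
    (∀ i ≤ ρ.1.length, ∀ f ∈ brSetF (x i) w, f ∈ F) ∧
    (∀ f ∈ F, f ∉ wfListed M ρ w x →
      ∀ i ≤ ρ.1.length, f.2.head? = some (x i) → f.2[1]? = some w)

/-! ### State atoms, generation, bow ties -/

/-- `g` is a brake of `F`. -/
def isBrake (F : Set Fact) (g : GroundTerm) : Prop := ((pBrake, [g]) : Fact) ∈ F

/-- A state atom of `F`: an atom `q(x, w)` with `q` a state of `M` and `x` not a brake. -/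
def StateAtom (M : NTM) (F : Set Fact) (f : Fact) : Prop :=
  ∃ q : ℕ, q < NTM.numStates M ∧ ∃ x wb : GroundTerm,
    f = ((pState q, [x, wb]) : Fact) ∧ f ∈ F ∧ ¬ isBrake F x

/-- `A` precedes `A'` in the derivation `c`: some applied trigger has `A` in its support
and `A'` in its output. -/
def precedes {S : RuleSet} {D : Set Fact} (c : Chase S D) (A A' : Fact) : Prop :=
  ∃ i : ℕ, (i : ℕ∞) < c.len ∧ A ∈ support (c.trig i) ∧ A' ∈ outputOf (c.trig i) (c.ext i)

/-- The fact `f` is generated (newly produced) at step `i` of the derivation `c`. -/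
def generatedAt {S : RuleSet} {D : Set Fact} (c : Chase S D) (i : ℕ) (f : Fact) : Prop :=
  (i : ℕ∞) < c.len ∧ f ∈ outputOf (c.trig i) (c.ext i) ∧ f ∉ c.fact i

/-- The fact `f` is generated by (an application of) one of the rules in `Rs`. -/
def generatedBy {S : RuleSet} {D : Set Fact} (c : Chase S D) (Rs : List Rule) (f : Fact) : Prop :=
  ∃ i : ℕ, generatedAt c i f ∧ (c.trig i).1 ∈ Rs

/-- Semantically meaningful terms: all terms of `F` except the brakes. -/
def semterms (F : Set Fact) : Set GroundTerm := {g | g ∈ termsOf F ∧ ¬ isBrake F g}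

/-- The edge relation `E_R`: `(x, y) ∈ E_R` iff `R(x, y, w) ∈ F` for some `w`. -/
def ER (F : Set Fact) (u v : GroundTerm) : Prop := ∃ w, ((pR, [u, v, w]) : Fact) ∈ F

/-- The weakly connected component of `x` in the graph induced by `E` on the vertex set `V`. -/
def wcc {α : Type} (V : Set α) (E : α → α → Prop) (x : α) : Set α :=
  {z | z ∈ V ∧ Relation.ReflTransGen (fun u v => u ∈ V ∧ v ∈ V ∧ (E u v ∨ E v u)) x z}

/-- Directed tree rooted in `r` on the vertex set `V` with edge relation `E`. -/
def IsDirTree {α : Type} (V : Set α) (E : α → α → Prop) (r : α) : Prop :=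
  r ∈ V ∧
  (∀ v ∈ V, Relation.ReflTransGen (fun u v' => u ∈ V ∧ v' ∈ V ∧ E u v') r v) ∧
  (∀ v ∈ V, v ≠ r → ∃! u, u ∈ V ∧ E u v) ∧
  (∀ u ∈ V, ¬ E u r)

/-- A bow tie with center `(x, y)` (Definition 6.2): `V_x^{-y}` induces a directed tree on the
inverse edges rooted in `x`, `V_y^{-x}` induces a directed tree rooted in `y`, and the two
components partition `V`. -/
def IsBowTie {α : Type} (V : Set α) (E : α → α → Prop) (x y : α) : Prop :=
  x ∈ V ∧ y ∈ V ∧ E x y ∧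
  IsDirTree (wcc (V \ {y}) E x) (fun u v => E v u) x ∧
  IsDirTree (wcc (V \ {x}) E y) E y ∧
  wcc (V \ {y}) E x ∩ wcc (V \ {x}) E y = ∅ ∧
  wcc (V \ {y}) E x ∪ wcc (V \ {x}) E y = V

/-- `bowtie(A)` for a state atom `q(x, w)`: the weakly connected component of `x` in
`(semterms F, E_R)`. -/
def bowtieOf (F : Set Fact) (x : GroundTerm) : Set GroundTerm := wcc (semterms F) (ER F) x

/-- A maximal `E`-path in the vertex set `V`. -/
def IsMaxPath {α : Type} (V : Set α) (E : α → α → Prop) (l : List α) : Prop :=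
  l ≠ [] ∧ (∀ z ∈ l, z ∈ V) ∧ List.Chain' E l ∧
  (∀ z ∈ V, ∀ a, l.head? = some a → ¬ E z a) ∧
  (∀ z ∈ V, ∀ a, l.getLast? = some a → ¬ E a z)

/-- `configs(A)` (Definition 6.4): one candidate configuration per maximal path of `bowtie(A)`. -/
def configsOf (M : NTM) (F : Set Fact) (A : Fact) : Set (Set Fact) :=
  {S | ∃ q : ℕ, ∃ x w : GroundTerm, A = ((pState q, [x, w]) : Fact) ∧
    ∃ l : List GroundTerm, IsMaxPath (bowtieOf F x) (ER F) l ∧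
      S = insert A
        ({f | ∃ z ∈ l, f ∈ brSetF z w} ∪
         {f | f ∈ F ∧ (f.1 = pR ∨ f.1 = pEnd ∨ ∃ a ∈ letters M, f.1 = pLetter a) ∧
           f.2 ≠ [] ∧ f.2.getLast? = some w ∧ ∀ z ∈ f.2.dropLast, z ∈ l})}

/-- Homomorphic embedding of fact sets: a map on nulls (fixing all constants) sending `S`
into `T`. -/
def mapG (h : ℕ → GroundTerm) : GroundTerm → GroundTerm
  | Sum.inl cc => Sum.inl cc
  | Sum.inr n => h n

def mapFact (h : ℕ → GroundTerm) (f : Fact) : Fact := (f.1, f.2.map (mapG h))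

def HomEmbeds (S T : Set Fact) : Prop := ∃ h : ℕ → GroundTerm, ∀ f ∈ S, mapFact h f ∈ T

end ChaseTermination
namespace ChaseTermination

/-! ### The machine `M_Σ` (Definition 4.1), modelled by its canonical runs

A run of `M_Σ` on the encoding of a database corresponds exactly to a restricted chase
derivation of `⟨Σ, D⟩` (step 4 of the procedure) together with the counter `j`; the machine
visits its designated state `q_r` once each time `j` is incremented (step 5), so a run visits
`q_r` infinitely often iff the derivation is infinite and `jseq` is unbounded. -/

open scoped Classical in
/-- The value of the counter `j` of `M_Σ` after `i` iterations of its main loop, when its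
non-deterministic choices build the chase derivation `c`. -/
noncomputable def jseq {S : RuleSet} {D : Set Fact} (c : Chase S D) : ℕ → ℕ
  | 0 => 0
  | i + 1 =>
      if ∀ t : Trigger, Active S (c.fact (jseq c i)) t → obsolete t (c.fact i) then
        jseq c i + 1
      else jseq c i

/-! ### Oblivious and core chase variants -/

/-- A (possibly infinite) oblivious chase derivation: triggers need only be loaded, but no
trigger (instance) is ever applied twice. -/
structure OblChase (S : RuleSet) (D : Set Fact) where
  len : ℕ∞
  fact : ℕ → Set Fact
  trig : ℕ → Trigger
  ext : ℕ → ℕ → GroundTerm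
  init : fact 0 = D
  memAt : ∀ i : ℕ, (i : ℕ∞) < len → (trig i).1 ∈ S
  loadAt : ∀ i : ℕ, (i : ℕ∞) < len → loaded (trig i) (fact i)
  noRepeat : ∀ i j : ℕ, (i : ℕ∞) < len → (j : ℕ∞) < len →
    instOf (trig i) = instOf (trig j) → i = j
  extOk : ∀ i : ℕ, (i : ℕ∞) < len → properExt (trig i) (fact i) (ext i)
  succ : ∀ i : ℕ, (i : ℕ∞) < len → fact (i + 1) = fact i ∪ outputOf (trig i) (ext i)
  stall : ∀ i : ℕ, ¬ ((i : ℕ∞) < len) → fact (i + 1) = fact i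

/-- Fairness for the oblivious chase: every trigger that becomes loaded is eventually applied. -/
def OblFair {S : RuleSet} {D : Set Fact} (c : OblChase S D) : Prop :=
  ∀ t : Trigger, t.1 ∈ S → ∀ i : ℕ, loaded t (c.fact i) →
    ∃ j : ℕ, (j : ℕ∞) < c.len ∧ instOf (c.trig j) = instOf t

/-- `H` is a retract of `G`: `H ⊆ G` and some homomorphism (fixing constants) maps `G` into `H`
leaving `H` pointwise fixed. -/
def RetractOf (G H : Set Fact) : Prop :=
  H ⊆ G ∧ ∃ h : ℕ → GroundTerm, (∀ f ∈ G, mapFact h f ∈ H) ∧ ∀ f ∈ H, mapFact h f = f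

/-- `H` is a core of `G`: a retract of `G` without proper retracts. -/
def IsCoreOf (H G : Set Fact) : Prop := RetractOf G H ∧ ∀ H', RetractOf H H' → H' = H

/-- `G` is obtained from `F` by applying all active triggers in parallel, each with fresh
pairwise distinct nulls (distinct trigger instances use disjoint fresh nulls). -/
def IsParallelStep (S : RuleSet) (F G : Set Fact) : Prop :=
  ∃ pe : Trigger → (ℕ → GroundTerm),
    (∀ t : Trigger, Active S F t → properExt t F (pe t)) ∧
    (∀ t t' : Trigger, Active S F t → Active S F t' → instOf t = instOf t' →
      outputOf t (pe t) = outputOf t' (pe t')) ∧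
    (∀ t t' : Trigger, Active S F t → Active S F t' → instOf t ≠ instOf t' →
      ∀ n : ℕ, (Sum.inr n : GroundTerm) ∉ termsOf F →
        (Sum.inr n : GroundTerm) ∈ termsOf (outputOf t (pe t)) →
        (Sum.inr n : GroundTerm) ∉ termsOf (outputOf t' (pe t'))) ∧
    G = F ∪ ⋃ t ∈ {t : Trigger | Active S F t}, outputOf t (pe t)

/-- A (possibly infinite) core chase sequence: `F_{i+1}` is a core of the parallel application
of all active triggers to `F_i`, and the sequence stops exactly when this is a fixpoint. -/
structure CoreChase (S : RuleSet) (D : Set Fact) where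
  len : ℕ∞
  fact : ℕ → Set Fact
  init : fact 0 = D
  step : ∀ i : ℕ, (i : ℕ∞) < len →
    ∃ G, IsParallelStep S (fact i) G ∧ IsCoreOf (fact (i + 1)) G ∧ fact (i + 1) ≠ fact i
  halt : ∀ i : ℕ, ¬ ((i : ℕ∞) < len) → ∃ G, IsParallelStep S (fact i) G ∧ IsCoreOf (fact i) G
  stall : ∀ i : ℕ, ¬ ((i : ℕ∞) < len) → fact (i + 1) = fact i

/-- The three chase variants. -/
inductive Variant : Type | obl | rest | core

/-- `qExists` ("sometimes") and `qForall` ("always") termination. -/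
inductive Quant : Type | qExists | qForall

/-- `Terminates v q S D`: the knowledge base `⟨S, D⟩` `q`-terminates for the chase variant `v`
(`qExists`: some chase sequence is finite; `qForall`: all chase sequences are finite). -/
def Terminates (v : Variant) (q : Quant) (S : RuleSet) (D : Set Fact) : Prop :=
  match v, q with
  | .rest, .qExists => ∃ c : Chase S D, Fair c ∧ c.len ≠ ⊤
  | .rest, .qForall => ∀ c : Chase S D, Fair c → c.len ≠ ⊤
  | .obl, .qExists => ∃ c : OblChase S D, OblFair c ∧ c.len ≠ ⊤
  | .obl, .qForall => ∀ c : OblChase S D, OblFair c → c.len ≠ ⊤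
  | .core, .qExists => ∃ c : CoreChase S D, c.len ≠ ⊤
  | .core, .qForall => ∀ c : CoreChase S D, c.len ≠ ⊤

end ChaseTermination

namespace ChaseTermination

theorem obsolete.mono {t : Trigger} {F G : Set Fact} (h : obsolete t F) (hFG : F ⊆ G) :
    obsolete t G :=
  let ⟨σ, hσ, hF⟩ := h
  ⟨σ, hσ, fun a ha => hFG (hF a ha)⟩

/-- Triggers with the same instance have the same substitution on body variables. -/
theorem eq_on_bodyVar_of_instOf_eq {t u : Trigger} (h : instOf t = instOf u) {v : ℕ}
    (hv : bodyVar t.1 v) : t.2 v = u.2 v := by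
  obtain ⟨r, σ⟩ := t
  obtain ⟨r', τ⟩ := u
  obtain ⟨rfl, hmap⟩ := Prod.mk.inj h
  obtain ⟨a, ha, hva⟩ := hv
  have hargs := (Prod.mk.inj (List.map_inj_left.1 hmap a ha)).2
  exact List.map_inj_left.1 hargs _ hva

theorem obsolete.of_instOf_eq {t u : Trigger} {F : Set Fact} (h : obsolete t F)
    (htu : instOf t = instOf u) : obsolete u F := by
  obtain ⟨σ, hσ, hF⟩ := h
  have hrule : t.1 = u.1 := (Prod.mk.inj htu).1
  refine ⟨σ, fun v hv => ?_, hrule ▸ hF⟩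
  rw [← hrule] at hv
  rw [hσ v hv, eq_on_bodyVar_of_instOf_eq htu hv]

theorem outputOf_finite (t : Trigger) (σ : ℕ → GroundTerm) : (outputOf t σ).Finite := by
  refine (t.1.2.finite_toSet.image (applyA σ)).subset ?_
  rintro f ⟨a, ha, rfl⟩
  exact ⟨a, ha, rfl⟩

theorem activeInsts_finite (S : RuleSet) {F : Set Fact} (hF : F.Finite) :
    (activeInsts S F).Finite := by
  have := hF.to_subtype
  refine (S.finite_toSet.biUnion fun r _ =>
    ((List.finite_length_eq F r.1.length).image fun l => (r, l.map Subtype.val))).subset ?_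
  rintro p ⟨t, ⟨hS, hl, -⟩, rfl⟩
  obtain ⟨l, hlt⟩ : t.1.1.map (applyA t.2) ∈ Set.range (List.map ((↑) : F → Fact)) := by
    rw [Set.range_list_map_coe]
    exact List.forall_mem_map.2 hl
  refine Set.mem_biUnion hS ⟨l, ?_, Prod.ext rfl hlt⟩
  have hlen := congrArg List.length hlt
  rwa [List.length_map, List.length_map] at hlen

namespace Chase

variable {S : RuleSet} {D : Set Fact} (c : Chase S D)

theorem fact_mono : Monotone c.fact := by
  refine monotone_nat_of_le_succ fun i => ?_
  by_cases h : (i : ℕ∞) < c.len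
  · rw [c.succ i h]
    exact Set.subset_union_left
  · rw [c.stall i h]

theorem fact_finite (hD : D.Finite) (i : ℕ) : (c.fact i).Finite := by
  induction i with
  | zero => rwa [c.init]
  | succ i ih =>
    by_cases h : (i : ℕ∞) < c.len
    · rw [c.succ i h]
      exact ih.union (outputOf_finite _ _)
    · rwa [c.stall i h]

theorem jseq_le (i : ℕ) : jseq c i ≤ i := by
  induction i with
  | zero => simp [jseq]
  | succ i ih => rw [jseq]; split_ifs <;> omega

/-- If the counter exceeds `n`, then at some step it was incremented from `n`. -/
theorem exists_jseq_eq_of_lt {n i : ℕ} (h : n < jseq c i) :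
    ∃ k, jseq c k = n ∧
      ∀ t : Trigger, Active S (c.fact n) t → obsolete t (c.fact k) := by
  induction i with
  | zero => simp [jseq] at h
  | succ i ih =>
    by_cases hi : n < jseq c i
    · exact ih hi
    rw [jseq] at h
    split_ifs at h with hob
    · obtain rfl : jseq c i = n := by omega
      exact ⟨i, rfl, hob⟩
    · exact absurd h hi

theorem fair_of_jseq_unbounded (h : ∀ N : ℕ, ∃ i : ℕ, N ≤ jseq c i) : Fair c := by
  intro t ht i hl
  obtain ⟨m, hm⟩ := h (i + 1)
  obtain ⟨k, hk, hob⟩ := c.exists_jseq_eq_of_lt hm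
  by_cases hi : obsolete t (c.fact i)
  · exact ⟨i, le_rfl, hi⟩
  · exact ⟨k, hk ▸ c.jseq_le k, hob t ⟨ht, hl, hi⟩⟩

/-- In a fair derivation from a finite fact set, the finitely many triggers active at one step
are simultaneously obsolete from some later step on. -/
theorem exists_forall_obsolete_of_fair (hD : D.Finite) (hc : Fair c) (n : ℕ) :
    ∃ k, ∀ i ≥ k, ∀ t : Trigger, Active S (c.fact n) t → obsolete t (c.fact i) := by
  have hfin := activeInsts_finite S (c.fact_finite hD n)
  have hev : ∀ p ∈ activeInsts S (c.fact n), ∃ k, ∀ t : Trigger, instOf t = p →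
      obsolete t (c.fact k) := by
    rintro p ⟨t, ⟨hS, hl, -⟩, rfl⟩
    obtain ⟨k, -, hk⟩ := hc t hS n hl
    exact ⟨k, fun u hu => hk.of_instOf_eq hu.symm⟩
  choose! K hK using hev
  obtain ⟨k, hk⟩ := (hfin.image K).bddAbove
  refine ⟨k, fun i hi t ht => ?_⟩
  have hp : instOf t ∈ activeInsts S (c.fact n) := ⟨t, ht, rfl⟩
  exact (hK _ hp t rfl).mono (c.fact_mono ((hk (Set.mem_image_of_mem K hp)).trans hi))

theorem jseq_unbounded_of_fair (hD : D.Finite) (hc : Fair c) (N : ℕ) :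
    ∃ i : ℕ, N ≤ jseq c i := by
  induction N with
  | zero => exact ⟨0, Nat.zero_le _⟩
  | succ N ih =>
    by_contra! hlt
    obtain ⟨i, hi⟩ := ih
    obtain ⟨k, hk⟩ := c.exists_forall_obsolete_of_fair hD hc N
    have hmono : Monotone (jseq c) := monotone_nat_of_le_succ fun m => by
      rw [jseq]; split_ifs <;> omega
    have hN : jseq c (max i k) = N := by
      have := hmono (le_max_left i k)
      have := hlt (max i k)
      omega
    have hstep := hlt (max i k + 1)
    rw [jseq, hN, if_pos (hk _ (le_max_right i k))] at hstep
    omega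

end Chase

/-- For every database `D` and finite rule set `Σ`, there is a run of the
non-deterministic machine `M_Σ` on the encoding of `D` that visits the designated state `q_r`
infinitely often if and only if there is a non-terminating (infinite, fair) restricted chase
sequence for `⟨Σ, D⟩`.

Runs of `M_Σ` on (the encoding of) `D` correspond exactly to restricted chase derivations of
`⟨Σ, D⟩`: step 4 of its procedure non-deterministically picks an active trigger, and the
machine visits `q_r` once each time its counter `j` is incremented (step 5). Hence a run
visiting `q_r` infinitely often is an infinite derivation `c` whose counter sequence
`jseq c` is unbounded. -/
theorem MSigma_recurring_iff_nonterminating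
    (S : RuleSet) (hS : IsRuleSet S) (D : Database) (hD : IsDatabase D) :
    (∃ c : Chase S (dbSet D), IsInfinite c ∧ ∀ N : ℕ, ∃ i : ℕ, N ≤ jseq c i) ↔
    (∃ c : Chase S (dbSet D), IsInfinite c ∧ Fair c) := by
  have hfin : (dbSet D).Finite := D.finite_toSet
  exact ⟨fun ⟨c, hinf, hc⟩ => ⟨c, hinf, c.fair_of_jseq_unbounded hc⟩,
    fun ⟨c, hinf, hc⟩ => ⟨c, hinf, c.jseq_unbounded_of_fair hfin hc⟩⟩

end ChaseTermination
end

section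
/- If (ρ_i)_{i∈ℕ} is a run of the machine M on the empty word that visits the designated state q_r infinitely often, then there exists an infinite (fair) restricted chase sequence for the knowledge base ⟨Σ_M, D_ε⟩. -/
namespace ChaseTermination

/-! ### Flattening and dovetailing -/

theorem exists_path_of_transGen {α : Type*} {r : α → α → Prop} {x y : α}
    (h : Relation.TransGen r x y) :
    ∃ (l : ℕ) (p : ℕ → α), p 0 = x ∧ p (l + 1) = y ∧ ∀ i ≤ l, r (p i) (p (i + 1)) := by
  induction h with
  | @single b h =>
    refine ⟨0, fun i => if i = 0 then x else b, by simp, by simp, ?_⟩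
    intro i hi
    obtain rfl : i = 0 := by omega
    simpa using h
  | @tail _ c _ h ih =>
    obtain ⟨l, p, h0, h1, hp⟩ := ih
    refine ⟨l + 1, Function.update p (l + 2) c, ?_, by simp, ?_⟩
    · rw [Function.update_of_ne (by omega), h0]
    · intro i hi
      rcases Nat.lt_or_ge l i with h' | h'
      · obtain rfl : i = l + 1 := by omega
        rw [Function.update_of_ne (by omega), h1, Function.update_self]
        exact h
      · rw [Function.update_of_ne (by omega), Function.update_of_ne (by omega)]
        exact hp i h'

/-- A sequence whose consecutive members are joined by paths refines to a sequence of single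
steps. -/
theorem exists_seq_of_transGen {α : Type*} {r : α → α → Prop} (a : ℕ → α)
    (h : ∀ n, Relation.TransGen r (a n) (a (n + 1))) :
    ∃ b : ℕ → α, b 0 = a 0 ∧ (∀ i, r (b i) (b (i + 1))) ∧ ∀ n, ∃ i, n ≤ i ∧ b i = a n := by
  choose l p hp0 hp1 hp using fun n => exists_path_of_transGen (h n)
  let next : ℕ × ℕ → ℕ × ℕ := fun s => if s.2 < l s.1 then (s.1, s.2 + 1) else (s.1 + 1, 0)
  let st : ℕ → ℕ × ℕ := fun i => next^[i] (0, 0)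
  have st_succ : ∀ i, st (i + 1) = next (st i) := fun i => Function.iterate_succ_apply' _ _ _
  have st_le : ∀ i, (st i).2 ≤ l (st i).1 := by
    intro i
    induction i with
    | zero => simp [st]
    | succ i ih =>
      rw [st_succ]
      by_cases hlt : (st i).2 < l (st i).1
      · simp only [next, if_pos hlt]; omega
      · simp [next, if_neg hlt]
  have st_add : ∀ n i, st i = (n, 0) → ∀ k ≤ l n, st (i + k) = (n, k) := by
    intro n i hi k
    induction k with
    | zero => intro _; exact hi
    | succ k ih =>
      intro hk
      rw [← Nat.add_assoc, st_succ, ih (by omega)]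
      simp only [next]
      rw [if_pos (by omega)]
  have hit : ∀ n, ∃ i, n ≤ i ∧ st i = (n, 0) := by
    intro n
    induction n with
    | zero => exact ⟨0, le_rfl, rfl⟩
    | succ n ih =>
      obtain ⟨i, hni, hi⟩ := ih
      refine ⟨i + l n + 1, by omega, ?_⟩
      rw [st_succ, st_add n i hi (l n) le_rfl]
      simp [next]
  refine ⟨fun i => p (st i).1 (st i).2, hp0 0, ?_, ?_⟩
  · intro i
    have hr := hp _ _ (st_le i)
    simp only [st_succ]
    by_cases hlt : (st i).2 < l (st i).1
    · simpa only [next, if_pos hlt] using hr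
    · have heq : (st i).2 = l (st i).1 := le_antisymm (st_le i) (not_lt.mp hlt)
      rw [heq, hp1] at hr
      simp only [next, if_neg hlt, hp0]
      rwa [heq]
  · intro n
    obtain ⟨i, hni, hi⟩ := hit n
    exact ⟨i, hni, by simp only [hi, hp0]⟩

theorem applyT_congr {σ τ : ℕ → GroundTerm} {t : RTerm}
    (h : ∀ v, t = Sum.inl v → σ v = τ v) : applyT σ t = applyT τ t := by
  cases t with
  | inl v => exact h v rfl
  | inr g => rfl

theorem applyA_congr {σ τ : ℕ → GroundTerm} {a : Atom}
    (h : ∀ v, atomHasVar a v → σ v = τ v) : applyA σ a = applyA τ a := by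
  unfold applyA
  congr 1
  apply List.map_congr_left
  intro t ht
  exact applyT_congr fun v hv => h v (by subst hv; exact ht)

theorem loaded_congr {r : Rule} {σ τ : ℕ → GroundTerm} {F : Set Fact}
    (h : ∀ v, bodyVar r v → σ v = τ v) (hl : loaded (r, σ) F) : loaded (r, τ) F := by
  intro a ha
  rw [← applyA_congr fun v hv => h v ⟨a, ha, hv⟩]
  exact hl a ha

theorem obsolete_congr {r : Rule} {σ τ : ℕ → GroundTerm} {F : Set Fact}
    (h : ∀ v, bodyVar r v → σ v = τ v) (ho : obsolete (r, σ) F) : obsolete (r, τ) F := by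
  obtain ⟨σ', hag, hh⟩ := ho
  exact ⟨σ', fun v hv => (hag v hv).trans (h v hv), hh⟩

theorem loaded_mono {t : Trigger} {F G : Set Fact} (h : F ⊆ G) (hl : loaded t F) : loaded t G :=
  fun a ha => h (hl a ha)

theorem exists_bodyVar_bound (r : Rule) : ∃ N, ∀ v, bodyVar r v → v < N := by
  have hfin : {v | bodyVar r v}.Finite := by
    have : {v | bodyVar r v} = ⋃ a ∈ {a | a ∈ r.1}, Sum.inl ⁻¹' {t : RTerm | t ∈ a.2} := by
      ext v
      simp [bodyVar, atomHasVar]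
    rw [this]
    exact (List.finite_toSet r.1).biUnion fun a _ =>
      (List.finite_toSet a.2).preimage Sum.inl_injective.injOn
  obtain ⟨N, hN⟩ := hfin.bddAbove
  exact ⟨N + 1, fun v hv => Nat.lt_succ_of_le (hN hv)⟩

theorem ChaseStep.subset {S : RuleSet} {F G : Set Fact} (h : ChaseStep S F G) : F ⊆ G := by
  obtain ⟨t, -, σ, -, rfl⟩ := h
  exact Set.subset_union_left

/-- Dovetailing: if from every good fact set and for every trigger there is a nonempty derivation
to a good fact set that takes care of the trigger, then there is an infinite fair derivation. -/
theorem exists_infinite_fair_chase {S : RuleSet} {D : Set Fact} (Good : Set Fact → Prop)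
    (hS : ∃ r, r ∈ S) (h0 : Good D)
    (h : ∀ F, Good F → ∀ t : Trigger, t.1 ∈ S →
      ∃ G, Relation.TransGen (ChaseStep S) F G ∧ Good G ∧ (loaded t F → obsolete t G)) :
    ∃ c : Chase S D, IsInfinite c ∧ Fair c := by
  classical
  obtain ⟨r₀, hr₀⟩ := hS
  let E := {r : Rule // r ∈ S} × List GroundTerm
  have : Nonempty E := ⟨(⟨r₀, hr₀⟩, [])⟩
  obtain ⟨e, he⟩ := exists_surjective_nat E
  let trg : E → Trigger := fun p => (p.1.1, fun v => p.2.getD v w1)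
  choose! next hnext using fun (F : Set Fact) (hF : Good F) (n : ℕ) =>
    h F hF (trg (e n.unpair.1)) (e n.unpair.1).1.2
  let a : ℕ → Set Fact := fun n => Nat.rec D (fun n F => next F n) n
  have a_succ : ∀ n, a (n + 1) = next (a n) n := fun _ => rfl
  have ha : ∀ n, Good (a n) := by
    intro n
    induction n with
    | zero => exact h0
    | succ n ih => exact (hnext _ ih n).2.1
  obtain ⟨b, hb0, hb, hhit⟩ := exists_seq_of_transGen a fun n => (hnext _ (ha n) n).1
  have hmono : Monotone b := monotone_nat_of_le_succ fun i => (hb i).subset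
  choose trig hact ext hext hsucc using hb
  refine ⟨⟨⊤, b, trig, ext, hb0, fun i _ => hact i, fun i _ => hext i, fun i _ => hsucc i,
    fun i hi => absurd (ENat.natCast_lt_top i) hi⟩, rfl, ?_⟩
  rintro ⟨r, σ⟩ hr i hl
  simp only at hr hl ⊢
  obtain ⟨N, hN⟩ := exists_bodyVar_bound r
  obtain ⟨m, hm⟩ := he (⟨r, hr⟩, (List.range N).map σ)
  have hσ : ∀ v, bodyVar r v → ((List.range N).map σ).getD v w1 = σ v := by
    intro v hv
    simp [List.getD, hN v hv]
  have hmi : i ≤ Nat.pair m i := Nat.right_le_pair m i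
  obtain ⟨j, hj, hbj⟩ := hhit (Nat.pair m i)
  obtain ⟨k, hk, hbk⟩ := hhit (Nat.pair m i + 1)
  refine ⟨k, by omega, ?_⟩
  have key := (hnext _ (ha (Nat.pair m i)) (Nat.pair m i)).2.2
  rw [Nat.unpair_pair, hm, ← a_succ, ← hbj, ← hbk] at key
  exact obsolete_congr hσ (key (loaded_congr (fun v hv => (hσ v hv).symm)
    (loaded_mono (hmono (by omega)) hl)))

/-! ### Firing triggers -/

theorem exists_properExt (t : Trigger) {F : Set Fact} (hF : F.Finite) :
    ∃ σ', properExt t F σ' := by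
  classical
  have hT : (termsOf F).Finite := by
    have : termsOf F = ⋃ f ∈ F, {g | g ∈ f.2} := by
      ext g
      simp [termsOf]
    rw [this]
    exact hF.biUnion fun f _ => List.finite_toSet f.2
  obtain ⟨N, hN⟩ := (hT.preimage (f := (Sum.inr : ℕ → GroundTerm))
    Sum.inr_injective.injOn).bddAbove
  refine ⟨fun v => if bodyVar t.1 v then t.2 v else Sum.inr (N + 1 + v), ?_, ?_, ?_⟩
  · intro v hv
    simp [hv]
  · intro v hv
    refine ⟨N + 1 + v, by simp [hv.2], fun hmem => ?_⟩
    have := hN hmem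
    omega
  · intro v w hv hw heq
    simpa [hv.2, hw.2] using heq

theorem apply_of_active {S : RuleSet} {t : Trigger} {F : Set Fact} (hF : F.Finite)
    (ht : Active S F t) :
    ∃ σ', properExt t F σ' ∧ ChaseStep S F (F ∪ outputOf t σ') ∧
      (F ∪ outputOf t σ').Finite := by
  obtain ⟨σ', hσ'⟩ := exists_properExt t hF
  exact ⟨σ', hσ', ⟨t, ht, σ', hσ', rfl⟩, hF.union (outputOf_finite t σ')⟩

/-- A loaded trigger can be made obsolete, by at most one chase step. -/
theorem exists_fire {S : RuleSet} {t : Trigger} {F : Set Fact} (hF : F.Finite) (hS : t.1 ∈ S)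
    (hl : loaded t F) :
    ∃ G σ', Relation.ReflTransGen (ChaseStep S) F G ∧ G.Finite ∧ F ⊆ G ∧ agreesOnBody t σ' ∧
      (∀ a ∈ t.1.2, applyA σ' a ∈ G) ∧ G ⊆ F ∪ outputOf t σ' := by
  by_cases ho : obsolete t F
  · obtain ⟨σ', hag, hh⟩ := ho
    exact ⟨F, σ', .refl, hF, subset_rfl, hag, hh, Set.subset_union_left⟩
  · obtain ⟨σ', hσ', hstep, hfin⟩ := apply_of_active hF ⟨hS, hl, ho⟩
    exact ⟨_, σ', .single hstep, hfin, Set.subset_union_left, hσ'.1,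
      fun a ha => Or.inr ⟨a, ha, rfl⟩, subset_rfl⟩

/-- No `nextBr`-atom starts in `w`. -/
def NoNextBr (w : GroundTerm) (F : Set Fact) : Prop := ∀ g, ((pNextBr, [w, g]) : Fact) ∉ F

theorem NoNextBr.of_subset_union {w : GroundTerm} {F G : Set Fact} {t : Trigger}
    {σ : ℕ → GroundTerm} (h : NoNextBr w F) (hG : G ⊆ F ∪ outputOf t σ)
    (ht : ∀ a ∈ t.1.2, a.1 ≠ pNextBr) : NoNextBr w G := by
  intro g hg
  rcases hG hg with hg | ⟨a, ha, heq⟩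
  · exact h g hg
  · exact ht a ha (congrArg Prod.fst heq).symm

theorem exists_fire_of_no_nextBr {S : RuleSet} {t : Trigger} {F : Set Fact} {w : GroundTerm}
    (hF : F.Finite) (hS : t.1 ∈ S) (hl : loaded t F) (hw : NoNextBr w F)
    (ht : ∀ a ∈ t.1.2, a.1 ≠ pNextBr) :
    ∃ G σ', Relation.ReflTransGen (ChaseStep S) F G ∧ G.Finite ∧ F ⊆ G ∧ NoNextBr w G ∧
      agreesOnBody t σ' ∧ (∀ a ∈ t.1.2, applyA σ' a ∈ G) := by
  obtain ⟨G, σ', h1, h2, h3, h4, h5, h6⟩ := exists_fire hF hS hl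
  exact ⟨G, σ', h1, h2, h3, hw.of_subset_union h6 ht, h4, h5⟩

/-! ### The rules of `Σ_M` -/

theorem mem_letters {M : NTM} {a : ℕ} : a ∈ letters M ↔ a ≤ NTM.blank M := by
  simp [letters]

theorem mem_transRules {M : NTM} {qr : ℕ} {r : Rule} :
    r ∈ transRules M qr ↔ ∃ e ∈ NTM.table M, ∃ c ∈ letters M,
      r = if e.2.2.2 = true then mkTransRight qr e.1.1 e.1.2 e.2.1 e.2.2.1 c
        else mkTransLeft qr e.1.1 e.1.2 e.2.1 e.2.2.1 c := by
  unfold transRules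
  induction NTM.table M with
  | nil => simp
  | cons e l ih =>
    simp only [List.foldr_cons, List.mem_append, List.mem_map, ih, List.mem_cons, exists_eq_or_imp,
      eq_comm (a := r)]

theorem mkTransRight_mem {M : NTM} {qr q a q' b c : ℕ}
    (h : ((q, a), (q', b, true)) ∈ NTM.table M) (hc : c ≤ NTM.blank M) :
    mkTransRight qr q a q' b c ∈ SigmaM M qr := by
  have : mkTransRight qr q a q' b c ∈ transRules M qr :=
    mem_transRules.2 ⟨_, h, c, mem_letters.2 hc, by simp⟩
  simp [SigmaM, this]

theorem mkTransLeft_mem {M : NTM} {qr q a q' b c : ℕ}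
    (h : ((q, a), (q', b, false)) ∈ NTM.table M) (hc : c ≤ NTM.blank M) :
    mkTransLeft qr q a q' b c ∈ SigmaM M qr := by
  have : mkTransLeft qr q a q' b c ∈ transRules M qr :=
    mem_transRules.2 ⟨_, h, c, mem_letters.2 hc, by simp⟩
  simp [SigmaM, this]

theorem mkCopyRight_mem {M : NTM} {qr a : ℕ} (ha : a ≤ NTM.blank M) :
    mkCopyRight a ∈ SigmaM M qr := by
  have : mkCopyRight a ∈ copyRightRules M := List.mem_map_of_mem (mem_letters.2 ha)
  simp [SigmaM, this]

theorem mkCopyLeft_mem {M : NTM} {qr a : ℕ} (ha : a ≤ NTM.blank M) :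
    mkCopyLeft a ∈ SigmaM M qr := by
  have : mkCopyLeft a ∈ copyLeftRules M := List.mem_map_of_mem (mem_letters.2 ha)
  simp [SigmaM, this]

theorem ruleEnd_mem {M : NTM} {qr : ℕ} : ruleEnd M ∈ SigmaM M qr := by
  simp [SigmaM]

theorem ne_pNextBr : (∀ a, pLetter a ≠ pNextBr) ∧ (∀ q, pState q ≠ pNextBr) ∧ pF ≠ pNextBr ∧
    pR ≠ pNextBr ∧ pCL ≠ pNextBr ∧ pCR ≠ pNextBr ∧ pReal ≠ pNextBr ∧ pBrake ≠ pNextBr ∧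
    pEnd ≠ pNextBr := by
  refine ⟨fun a => ?_, fun q => ?_, ?_⟩
  · unfold pLetter pNextBr; omega
  · unfold pState pNextBr; omega
  · decide

/-- In all rules, the source of a `nextBr`-atom in the head is the universal variable `w`. -/
theorem nextBr_head {M : NTM} {qr : ℕ} {r : Rule} (hr : r ∈ SigmaM M qr) :
    bodyVar r 4 ∧ ∀ a ∈ r.2, a.1 = pNextBr → a.2.head? = some (tv 4) := by
  simp only [SigmaM, List.mem_append, List.mem_cons, List.not_mem_nil, or_false, mem_transRules,
    copyLeftRules, copyRightRules, List.mem_map] at hr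
  rcases hr with ((((rfl | rfl) | ⟨e, -, c, -, rfl⟩) | ⟨a, -, rfl⟩) | ⟨a, -, rfl⟩) | rfl
  · simp [ruleBrake, bodyVar, atomHasVar, A1, A2, A3, tv, or_imp, forall_and, ne_pNextBr]
  · simp [ruleNextBr, bodyVar, atomHasVar, A1, A2, A3, tv, brSetA, ne_pNextBr]
  · split_ifs
    · unfold mkTransRight
      split_ifs <;> simp [bodyVar, atomHasVar, A1, A2, A3, tv, brSetA, ne_pNextBr]
    · unfold mkTransLeft
      split_ifs <;> simp [bodyVar, atomHasVar, A1, A2, A3, tv, brSetA, ne_pNextBr]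
  · simp [mkCopyLeft, bodyVar, atomHasVar, A1, A2, A3, tv, brSetA, ne_pNextBr]
  · simp [mkCopyRight, bodyVar, atomHasVar, A1, A2, A3, tv, brSetA, ne_pNextBr]
  · simp [ruleEnd, bodyVar, atomHasVar, A1, A2, A3, tv, brSetA, ne_pNextBr]

theorem NoNextBr.of_trigger {M : NTM} {qr : ℕ} {t : Trigger} {σ : ℕ → GroundTerm} {F : Set Fact}
    {w : GroundTerm} (h : NoNextBr w F) (ht : t.1 ∈ SigmaM M qr) (hσ : agreesOnBody t σ)
    (hne : t.2 4 ≠ w) : NoNextBr w (F ∪ outputOf t σ) := by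
  rintro g (hg | ⟨a, ha, heq⟩)
  · exact h g hg
  · obtain ⟨h4, hhead⟩ := nextBr_head ht
    have := hhead a ha (congrArg Prod.fst heq).symm
    have h2 : [w, g] = a.2.map (applyT σ) := congrArg Prod.snd heq
    have h3 := congrArg List.head? h2
    rw [List.head?_map, this] at h3
    simp only [List.head?_cons, Option.map_some, Option.some.injEq, tv, applyT] at h3
    exact hne (by rw [h3, hσ 4 h4])

/-- The substitution of the six rule variables with the universal values given. -/
def ruleSubst (x y x' w w' : GroundTerm) : ℕ → GroundTerm
  | 0 => x
  | 1 => y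
  | 2 => x'
  | 4 => w
  | _ => w'

theorem mem_brSetF_iff {F : Set Fact} {x w : GroundTerm} :
    (∀ f ∈ brSetF x w, f ∈ F) ↔ ((pF, [x, w, w]) : Fact) ∈ F ∧ ((pR, [x, w, w]) : Fact) ∈ F ∧
      ((pReal, [x]) : Fact) ∈ F ∧ ((pBrake, [w]) : Fact) ∈ F := by
  simp [brSetF]

theorem fire_copyRight {M : NTM} {qr a : ℕ} (ha : a ≤ NTM.blank M) {F : Set Fact}
    (hF : F.Finite) {x y x' w w' : GroundTerm} (hw : NoNextBr w' F)
    (h1 : ((pCR, [x', w']) : Fact) ∈ F) (h2 : ((pF, [x, x', w']) : Fact) ∈ F)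
    (h3 : ((pR, [x, y, w]) : Fact) ∈ F) (h4 : ((pLetter a, [y, w]) : Fact) ∈ F)
    (h5 : ∀ f ∈ brSetF x w, f ∈ F) (h6 : ∀ f ∈ brSetF x' w', f ∈ F)
    (h7 : ∀ f ∈ brSetF y w, f ∈ F) :
    ∃ G y', Relation.ReflTransGen (ChaseStep (SigmaM M qr)) F G ∧ G.Finite ∧ F ⊆ G ∧
      NoNextBr w' G ∧ ((pF, [y, y', w']) : Fact) ∈ G ∧ ((pR, [x', y', w']) : Fact) ∈ G ∧
      ((pLetter a, [y', w']) : Fact) ∈ G ∧ ((pCR, [y', w']) : Fact) ∈ G ∧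
      ∀ f ∈ brSetF y' w', f ∈ G := by
  rw [mem_brSetF_iff] at h5 h6 h7
  obtain ⟨G, σ, r1, r2, r3, r4, hag, hh⟩ := exists_fire_of_no_nextBr (w := w')
    (t := (mkCopyRight a, ruleSubst x y x' w w')) hF (mkCopyRight_mem (qr := qr) ha)
    (by simp [loaded, mkCopyRight, brSetA, A1, A2, A3, tv, applyA, applyT, ruleSubst, *]) hw
    (by simp [mkCopyRight, brSetA, A1, A2, A3, ne_pNextBr])
  have e1 : σ 1 = y := hag 1 (by simp [bodyVar, atomHasVar, mkCopyRight, A2, A3, tv])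
  have e2 : σ 2 = x' := hag 2 (by simp [bodyVar, atomHasVar, mkCopyRight, A2, A3, tv])
  have e5 : σ 5 = w' := hag 5 (by simp [bodyVar, atomHasVar, mkCopyRight, A2, A3, tv])
  refine ⟨G, σ 3, r1, r2, r3, r4, ?_⟩
  simpa [mkCopyRight, brSetA, A1, A2, A3, tv, applyA, applyT, e1, e2, e5, brSetF, and_assoc]
    using hh

theorem fire_copyLeft {M : NTM} {qr a : ℕ} (ha : a ≤ NTM.blank M) {F : Set Fact}
    (hF : F.Finite) {x y x' w w' : GroundTerm} (hw : NoNextBr w' F)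
    (h1 : ((pCL, [x', w']) : Fact) ∈ F) (h2 : ((pF, [x, x', w']) : Fact) ∈ F)
    (h3 : ((pR, [y, x, w]) : Fact) ∈ F) (h4 : ((pLetter a, [y, w]) : Fact) ∈ F)
    (h5 : ∀ f ∈ brSetF x w, f ∈ F) (h6 : ∀ f ∈ brSetF x' w', f ∈ F)
    (h7 : ∀ f ∈ brSetF y w, f ∈ F) :
    ∃ G y', Relation.ReflTransGen (ChaseStep (SigmaM M qr)) F G ∧ G.Finite ∧ F ⊆ G ∧
      NoNextBr w' G ∧ ((pF, [y, y', w']) : Fact) ∈ G ∧ ((pR, [y', x', w']) : Fact) ∈ G ∧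
      ((pLetter a, [y', w']) : Fact) ∈ G ∧ ((pCL, [y', w']) : Fact) ∈ G ∧
      ∀ f ∈ brSetF y' w', f ∈ G := by
  rw [mem_brSetF_iff] at h5 h6 h7
  obtain ⟨G, σ, r1, r2, r3, r4, hag, hh⟩ := exists_fire_of_no_nextBr (w := w')
    (t := (mkCopyLeft a, ruleSubst x y x' w w')) hF (mkCopyLeft_mem (qr := qr) ha)
    (by simp [loaded, mkCopyLeft, brSetA, A1, A2, A3, tv, applyA, applyT, ruleSubst, *]) hw
    (by simp [mkCopyLeft, brSetA, A1, A2, A3, ne_pNextBr])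
  have e1 : σ 1 = y := hag 1 (by simp [bodyVar, atomHasVar, mkCopyLeft, A2, A3, tv])
  have e2 : σ 2 = x' := hag 2 (by simp [bodyVar, atomHasVar, mkCopyLeft, A2, A3, tv])
  have e5 : σ 5 = w' := hag 5 (by simp [bodyVar, atomHasVar, mkCopyLeft, A2, A3, tv])
  refine ⟨G, σ 3, r1, r2, r3, r4, ?_⟩
  simpa [mkCopyLeft, brSetA, A1, A2, A3, tv, applyA, applyT, e1, e2, e5, brSetF, and_assoc]
    using hh

theorem fire_end {M : NTM} {qr : ℕ} {F : Set Fact} (hF : F.Finite) {x x' w w' : GroundTerm}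
    (hw : NoNextBr w' F) (h1 : ((pCR, [x', w']) : Fact) ∈ F)
    (h2 : ((pF, [x, x', w']) : Fact) ∈ F) (h3 : ((pEnd, [x, w]) : Fact) ∈ F)
    (h4 : ∀ f ∈ brSetF x w, f ∈ F) (h5 : ∀ f ∈ brSetF x' w', f ∈ F) :
    ∃ G y', Relation.ReflTransGen (ChaseStep (SigmaM M qr)) F G ∧ G.Finite ∧ F ⊆ G ∧
      NoNextBr w' G ∧ ((pR, [x', y', w']) : Fact) ∈ G ∧
      ((pLetter (NTM.blank M), [y', w']) : Fact) ∈ G ∧ ((pEnd, [y', w']) : Fact) ∈ G ∧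
      ∀ f ∈ brSetF y' w', f ∈ G := by
  rw [mem_brSetF_iff] at h4 h5
  obtain ⟨G, σ, r1, r2, r3, r4, hag, hh⟩ := exists_fire_of_no_nextBr (w := w')
    (t := (ruleEnd M, ruleSubst x x x' w w')) hF (ruleEnd_mem (qr := qr))
    (by simp [loaded, ruleEnd, brSetA, A1, A2, A3, tv, applyA, applyT, ruleSubst, *]) hw
    (by simp [ruleEnd, brSetA, A1, A2, A3, ne_pNextBr])
  have e2 : σ 2 = x' := hag 2 (by simp [bodyVar, atomHasVar, ruleEnd, A2, A3, tv])
  have e5 : σ 5 = w' := hag 5 (by simp [bodyVar, atomHasVar, ruleEnd, A2, A3, tv])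
  refine ⟨G, σ 3, r1, r2, r3, r4, ?_⟩
  simpa [ruleEnd, brSetA, A1, A2, A3, tv, applyA, applyT, e2, e5, brSetF, and_assoc] using hh

/-- Firing a trigger that creates a fresh successor of the brake `w`. -/
theorem exists_fire_fresh {M : NTM} {qr : ℕ} {t : Trigger} {F : Set Fact} {w : GroundTerm}
    (hF : F.Finite) (hS : t.1 ∈ SigmaM M qr) (hl : loaded t F) (hw : NoNextBr w F)
    (htw : t.2 4 = w) (hwF : w ∈ termsOf F) (hnext : A2 pNextBr (tv 4) (tv 5) ∈ t.1.2)
    (h5 : ¬ bodyVar t.1 5) :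
    ∃ G σ', Relation.TransGen (ChaseStep (SigmaM M qr)) F G ∧ G.Finite ∧ F ⊆ G ∧
      NoNextBr (σ' 5) G ∧ σ' 5 ≠ w ∧ agreesOnBody t σ' ∧ (∀ a ∈ t.1.2, applyA σ' a ∈ G) := by
  have h4 := (nextBr_head hS).1
  have hno : ¬ obsolete t F := by
    rintro ⟨σ, hag, hh⟩
    have := hh _ hnext
    simp only [applyA, A2, tv, List.map_cons, List.map_nil, applyT, hag 4 h4, htw] at this
    exact hw _ this
  obtain ⟨σ', hσ', hstep, hfin⟩ := apply_of_active hF ⟨hS, hl, hno⟩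
  obtain ⟨n, hn, hnF⟩ := hσ'.2.1 5 ⟨⟨_, hnext, by simp [atomHasVar, A2, tv]⟩, h5⟩
  rw [← hn] at hnF
  have hne : σ' 5 ≠ w := fun h => hnF (h ▸ hwF)
  refine ⟨_, σ', .single hstep, hfin, Set.subset_union_left, ?_, hne, hσ'.1,
    fun a ha => Or.inr ⟨a, ha, rfl⟩⟩
  exact NoNextBr.of_trigger (fun g hg => hnF ⟨_, hg, by simp⟩) hS hσ'.1 (htw ▸ hne.symm)

theorem fire_transRight {M : NTM} {qr q a q' b c : ℕ}
    (he : ((q, a), (q', b, true)) ∈ NTM.table M) (hc : c ≤ NTM.blank M) {F : Set Fact}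
    (hF : F.Finite) {x y w : GroundTerm} (hw : NoNextBr w F)
    (h1 : ((pState q, [x, w]) : Fact) ∈ F) (h2 : ((pLetter a, [x, w]) : Fact) ∈ F)
    (h3 : ((pR, [x, y, w]) : Fact) ∈ F) (h4 : ((pLetter c, [y, w]) : Fact) ∈ F)
    (h5 : ∀ f ∈ brSetF x w, f ∈ F) (h6 : ∀ f ∈ brSetF y w, f ∈ F) :
    ∃ G w' x' y', Relation.ReflTransGen (ChaseStep (SigmaM M qr)) F G ∧ G.Finite ∧ F ⊆ G ∧
      NoNextBr w' G ∧ (q ≠ qr → w' = w) ∧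
      (q = qr → w' ≠ w ∧ Relation.TransGen (ChaseStep (SigmaM M qr)) F G) ∧
      ((pState q', [y', w']) : Fact) ∈ G ∧ ((pLetter c, [y', w']) : Fact) ∈ G ∧
      ((pLetter b, [x', w']) : Fact) ∈ G ∧ ((pR, [x', y', w']) : Fact) ∈ G ∧
      ((pF, [x, x', w']) : Fact) ∈ G ∧ ((pF, [y, y', w']) : Fact) ∈ G ∧
      ((pCL, [x', w']) : Fact) ∈ G ∧ ((pCR, [y', w']) : Fact) ∈ G ∧
      (∀ f ∈ brSetF x' w', f ∈ G) ∧ (∀ f ∈ brSetF y' w', f ∈ G) := by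
  rw [mem_brSetF_iff] at h5 h6
  have hS := mkTransRight_mem (qr := qr) he hc
  have hl : loaded (mkTransRight qr q a q' b c, ruleSubst x y x w w) F := by
    simp [loaded, mkTransRight, brSetA, A1, A2, A3, tv, applyA, applyT, ruleSubst, *]
  have b0 : bodyVar (mkTransRight qr q a q' b c) 0 := by
    simp [bodyVar, atomHasVar, mkTransRight, A2, A3, tv]
  have b1 : bodyVar (mkTransRight qr q a q' b c) 1 := by
    simp [bodyVar, atomHasVar, mkTransRight, A2, A3, tv]
  have b4 : bodyVar (mkTransRight qr q a q' b c) 4 := by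
    simp [bodyVar, atomHasVar, mkTransRight, A2, A3, tv]
  by_cases hq : q = qr
  · obtain ⟨G, σ, r1, r2, r3, r4, r5, hag, hh⟩ := exists_fire_fresh hF hS hl hw rfl
      ⟨_, h1, by simp⟩ (by simp [mkTransRight, hq])
      (by simp [bodyVar, atomHasVar, mkTransRight, A1, A2, A3, tv, brSetA])
    refine ⟨G, σ 5, σ 2, σ 3, r1.to_reflTransGen, r2, r3, r4, fun h => absurd hq h,
      fun _ => ⟨r5, r1⟩, ?_⟩
    have e0 : σ 0 = x := hag 0 b0
    have e1 : σ 1 = y := hag 1 b1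
    have e4 : σ 4 = w := hag 4 b4
    simp [mkTransRight, hq, brSetA, A1, A2, A3, tv, applyA, applyT, e0, e1, e4] at hh
    simp only [mem_brSetF_iff]
    tauto
  · obtain ⟨G, σ, r1, r2, r3, r4, hag, hh⟩ := exists_fire_of_no_nextBr hF hS hl hw
      (by simp [mkTransRight, hq, brSetA, A1, A2, A3, ne_pNextBr])
    refine ⟨G, w, σ 2, σ 3, r1, r2, r3, r4, fun _ => rfl, fun h => absurd h hq, ?_⟩
    have e0 : σ 0 = x := hag 0 b0
    have e1 : σ 1 = y := hag 1 b1
    have e4 : σ 4 = w := hag 4 b4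
    simp [mkTransRight, hq, brSetA, A1, A2, A3, tv, applyA, applyT, e0, e1, e4] at hh
    simp only [mem_brSetF_iff]
    tauto

theorem fire_transLeft {M : NTM} {qr q a q' b c : ℕ}
    (he : ((q, a), (q', b, false)) ∈ NTM.table M) (hc : c ≤ NTM.blank M) {F : Set Fact}
    (hF : F.Finite) {x y w : GroundTerm} (hw : NoNextBr w F)
    (h1 : ((pState q, [x, w]) : Fact) ∈ F) (h2 : ((pLetter a, [x, w]) : Fact) ∈ F)
    (h3 : ((pR, [y, x, w]) : Fact) ∈ F) (h4 : ((pLetter c, [y, w]) : Fact) ∈ F)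
    (h5 : ∀ f ∈ brSetF x w, f ∈ F) (h6 : ∀ f ∈ brSetF y w, f ∈ F) :
    ∃ G w' x' y', Relation.ReflTransGen (ChaseStep (SigmaM M qr)) F G ∧ G.Finite ∧ F ⊆ G ∧
      NoNextBr w' G ∧ (q ≠ qr → w' = w) ∧
      (q = qr → w' ≠ w ∧ Relation.TransGen (ChaseStep (SigmaM M qr)) F G) ∧
      ((pState q', [y', w']) : Fact) ∈ G ∧ ((pLetter c, [y', w']) : Fact) ∈ G ∧
      ((pLetter b, [x', w']) : Fact) ∈ G ∧ ((pR, [y', x', w']) : Fact) ∈ G ∧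
      ((pF, [x, x', w']) : Fact) ∈ G ∧ ((pF, [y, y', w']) : Fact) ∈ G ∧
      ((pCL, [y', w']) : Fact) ∈ G ∧ ((pCR, [x', w']) : Fact) ∈ G ∧
      (∀ f ∈ brSetF x' w', f ∈ G) ∧ (∀ f ∈ brSetF y' w', f ∈ G) := by
  rw [mem_brSetF_iff] at h5 h6
  have hS := mkTransLeft_mem (qr := qr) he hc
  have hl : loaded (mkTransLeft qr q a q' b c, ruleSubst x y x w w) F := by
    simp [loaded, mkTransLeft, brSetA, A1, A2, A3, tv, applyA, applyT, ruleSubst, *]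
  have b0 : bodyVar (mkTransLeft qr q a q' b c) 0 := by
    simp [bodyVar, atomHasVar, mkTransLeft, A2, A3, tv]
  have b1 : bodyVar (mkTransLeft qr q a q' b c) 1 := by
    simp [bodyVar, atomHasVar, mkTransLeft, A2, A3, tv]
  have b4 : bodyVar (mkTransLeft qr q a q' b c) 4 := by
    simp [bodyVar, atomHasVar, mkTransLeft, A2, A3, tv]
  by_cases hq : q = qr
  · obtain ⟨G, σ, r1, r2, r3, r4, r5, hag, hh⟩ := exists_fire_fresh hF hS hl hw rfl
      ⟨_, h1, by simp⟩ (by simp [mkTransLeft, hq])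
      (by simp [bodyVar, atomHasVar, mkTransLeft, A1, A2, A3, tv, brSetA])
    refine ⟨G, σ 5, σ 2, σ 3, r1.to_reflTransGen, r2, r3, r4, fun h => absurd hq h,
      fun _ => ⟨r5, r1⟩, ?_⟩
    have e0 : σ 0 = x := hag 0 b0
    have e1 : σ 1 = y := hag 1 b1
    have e4 : σ 4 = w := hag 4 b4
    simp [mkTransLeft, hq, brSetA, A1, A2, A3, tv, applyA, applyT, e0, e1, e4] at hh
    simp only [mem_brSetF_iff]
    tauto
  · obtain ⟨G, σ, r1, r2, r3, r4, hag, hh⟩ := exists_fire_of_no_nextBr hF hS hl hw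
      (by simp [mkTransLeft, hq, brSetA, A1, A2, A3, ne_pNextBr])
    refine ⟨G, w, σ 2, σ 3, r1, r2, r3, r4, fun _ => rfl, fun h => absurd h hq, ?_⟩
    have e0 : σ 0 = x := hag 0 b0
    have e1 : σ 1 = y := hag 1 b1
    have e4 : σ 4 = w := hag 4 b4
    simp [mkTransLeft, hq, brSetA, A1, A2, A3, tv, applyA, applyT, e0, e1, e4] at hh
    simp only [mem_brSetF_iff]
    tauto

/-! ### Simulating the machine -/

/-- The terms `x 0, …, x n` represent a configuration with tape content `letter`, head position `p`
and state `q`, overseen by the brake `w`. -/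
structure Frontier (F : Set Fact) (w : GroundTerm) (n : ℕ) (letter : ℕ → ℕ) (p q : ℕ)
    (x : ℕ → GroundTerm) : Prop where
  succ : ∀ i < n, ((pR, [x i, x (i + 1), w]) : Fact) ∈ F
  letter : ∀ i ≤ n, ((pLetter (letter i), [x i, w]) : Fact) ∈ F
  brSet : ∀ i ≤ n, ∀ f ∈ brSetF (x i) w, f ∈ F
  state : ((pState q, [x p, w]) : Fact) ∈ F
  fin : ((pEnd, [x n, w]) : Fact) ∈ F

theorem Frontier.mono {F G : Set Fact} {w : GroundTerm} {n : ℕ} {letter : ℕ → ℕ} {p q : ℕ}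
    {x : ℕ → GroundTerm} (h : Frontier F w n letter p q x) (hFG : F ⊆ G) :
    Frontier G w n letter p q x :=
  ⟨fun i hi => hFG (h.succ i hi), fun i hi => hFG (h.letter i hi),
    fun i hi f hf => hFG (h.brSet i hi f hf), hFG h.state, hFG h.fin⟩

/-- The segment `x' lo, …, x' hi` of the successor configuration of the one on `x` has been
built, under the brake `w`. -/
structure Segment (F : Set Fact) (w : GroundTerm) (lo hi : ℕ) (letter : ℕ → ℕ) (p q : ℕ)
    (x x' : ℕ → GroundTerm) : Prop where
  lo_le : lo ≤ p
  le_hi : p ≤ hi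
  succ : ∀ i, lo ≤ i → i < hi → ((pR, [x' i, x' (i + 1), w]) : Fact) ∈ F
  next : ∀ i, lo ≤ i → i ≤ hi → ((pF, [x i, x' i, w]) : Fact) ∈ F
  letter : ∀ i, lo ≤ i → i ≤ hi → ((pLetter (letter i), [x' i, w]) : Fact) ∈ F
  brSet : ∀ i, lo ≤ i → i ≤ hi → ∀ f ∈ brSetF (x' i) w, f ∈ F
  state : ((pState q, [x' p, w]) : Fact) ∈ F
  left : ((pCL, [x' lo, w]) : Fact) ∈ F
  right : ((pCR, [x' hi, w]) : Fact) ∈ F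

theorem Segment.extend_right {M : NTM} {qr : ℕ} {F : Set Fact} {w w' : GroundTerm}
    {n : ℕ} {l l' : ℕ → ℕ} {p q p' q' lo hi : ℕ} {x x' : ℕ → GroundTerm}
    (hseg : Segment F w' lo hi l' p' q' x x') (hfr : Frontier F w n l p q x)
    (hF : F.Finite) (hw : NoNextBr w' F) (hl : ∀ i, hi < i → l' i = l i)
    (hb : ∀ i, l i ≤ NTM.blank M) (d : ℕ) (hd : hi + d ≤ n) :
    ∃ G x'', Relation.ReflTransGen (ChaseStep (SigmaM M qr)) F G ∧ G.Finite ∧ F ⊆ G ∧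
      NoNextBr w' G ∧ Segment G w' lo (hi + d) l' p' q' x x'' := by
  induction d with
  | zero => exact ⟨F, x', .refl, hF, subset_rfl, hw, hseg⟩
  | succ d ih =>
    obtain ⟨G, x'', s1, s2, s3, s4, s⟩ := ih (by omega)
    have hlo := s.lo_le
    have hhi := s.le_hi
    have fr := hfr.mono s3
    obtain ⟨H, y, t1, t2, t3, t4, u1, u2, u3, u4, u5⟩ := fire_copyRight (qr := qr) (hb (hi + d + 1))
      s2 s4 s.right (s.next _ (by omega) le_rfl) (fr.succ (hi + d) (by omega))
      (fr.letter _ (by omega)) (fr.brSet _ (by omega)) (s.brSet _ (by omega) le_rfl)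
      (fr.brSet _ (by omega))
    refine ⟨H, Function.update x'' (hi + d + 1) y, s1.trans t1, t2, s3.trans t3, t4, ?_⟩
    have self : Function.update x'' (hi + d + 1) y (hi + d + 1) = y := Function.update_self ..
    have old : ∀ i, i ≤ hi + d → Function.update x'' (hi + d + 1) y i = x'' i :=
      fun i hi => Function.update_of_ne (by omega) ..
    have cases : ∀ {i}, i ≤ hi + (d + 1) → i ≤ hi + d ∨ i = hi + d + 1 := by omega
    refine ⟨hlo, by omega, ?_, ?_, ?_, ?_, ?_, ?_, ?_⟩
    · intro i h1 h2
      rcases cases h2 with h | h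
      · rw [old i (by omega), old _ h]
        exact t3 (s.succ i h1 h)
      · obtain rfl : i = hi + d := by omega
        rw [self, old _ le_rfl]
        exact u2
    · intro i h1 h2
      rcases cases h2 with h | rfl
      · rw [old i h]
        exact t3 (s.next i h1 h)
      · rw [self]
        exact u1
    · intro i h1 h2
      rcases cases h2 with h | rfl
      · rw [old i h]
        exact t3 (s.letter i h1 h)
      · rw [self, hl _ (by omega)]
        exact u3
    · intro i h1 h2
      rcases cases h2 with h | rfl
      · rw [old i h]
        exact fun f hf => t3 (s.brSet i h1 h f hf)
      · rw [self]
        exact u5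
    · rw [old _ hhi]
      exact t3 s.state
    · rw [old _ (by omega)]
      exact t3 s.left
    · rw [← Nat.add_assoc, self]
      exact u4

theorem Segment.extend_left {M : NTM} {qr : ℕ} {F : Set Fact} {w w' : GroundTerm}
    {n : ℕ} {l l' : ℕ → ℕ} {p q p' q' hi : ℕ} {x : ℕ → GroundTerm}
    (hfr : Frontier F w n l p q x) (hn : hi ≤ n) (hb : ∀ i, l i ≤ NTM.blank M) :
    ∀ {lo : ℕ} {G : Set Fact} {x' : ℕ → GroundTerm}, F ⊆ G →
      Segment G w' lo hi l' p' q' x x' → G.Finite → NoNextBr w' G →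
      (∀ i, i < lo → l' i = l i) →
    ∃ H x'', Relation.ReflTransGen (ChaseStep (SigmaM M qr)) G H ∧ H.Finite ∧ G ⊆ H ∧
      NoNextBr w' H ∧ Segment H w' 0 hi l' p' q' x x'' := by
  intro lo
  induction lo with
  | zero =>
    intro G x' _ hseg hG hw _
    exact ⟨G, x', .refl, hG, subset_rfl, hw, hseg⟩
  | succ lo ih =>
    intro G x' hFG s hG hw hl
    have hlo := s.lo_le
    have hhi := s.le_hi
    have fr := hfr.mono hFG
    obtain ⟨H, y, t1, t2, t3, t4, u1, u2, u3, u4, u5⟩ := fire_copyLeft (qr := qr) (hb lo)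
      hG hw s.left (s.next _ le_rfl (by omega)) (fr.succ lo (by omega))
      (fr.letter _ (by omega)) (fr.brSet _ (by omega)) (s.brSet _ le_rfl (by omega))
      (fr.brSet _ (by omega))
    have self : Function.update x' lo y lo = y := Function.update_self ..
    have old : ∀ i, lo + 1 ≤ i → Function.update x' lo y i = x' i :=
      fun i hi => Function.update_of_ne (by omega) ..
    have cases : ∀ {i}, lo ≤ i → lo + 1 ≤ i ∨ i = lo := by omega
    have seg : Segment H w' lo hi l' p' q' x (Function.update x' lo y) := by
      refine ⟨by omega, hhi, ?_, ?_, ?_, ?_, ?_, ?_, ?_⟩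
      · intro i h1 h2
        rcases cases h1 with h | rfl
        · rw [old i h, old _ (by omega)]
          exact t3 (s.succ i h h2)
        · rw [self, old _ le_rfl]
          exact u2
      · intro i h1 h2
        rcases cases h1 with h | rfl
        · rw [old i h]
          exact t3 (s.next i h h2)
        · rw [self]
          exact u1
      · intro i h1 h2
        rcases cases h1 with h | rfl
        · rw [old i h]
          exact t3 (s.letter i h h2)
        · rw [self, hl _ (by omega)]
          exact u3
      · intro i h1 h2
        rcases cases h1 with h | rfl
        · rw [old i h]
          exact fun f hf => t3 (s.brSet i h h2 f hf)
        · rw [self]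
          exact u5
      · rw [old _ hlo]
        exact t3 s.state
      · rw [self]
        exact u4
      · rw [old _ (by omega)]
        exact t3 s.right
    obtain ⟨K, x'', v1, v2, v3, v4, v5⟩ := ih (hFG.trans t3) seg t2 t4
      fun i hi => hl i (by omega)
    exact ⟨K, x'', t1.trans v1, v2, t3.trans v3, v4, v5⟩

/-- A segment containing the head position can be completed to the whole configuration. -/
theorem Segment.complete {M : NTM} {qr : ℕ} {F : Set Fact} {w w' : GroundTerm}
    {n : ℕ} {l l' : ℕ → ℕ} {p q p' q' lo hi : ℕ} {x x' : ℕ → GroundTerm}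
    (hseg : Segment F w' lo hi l' p' q' x x') (hfr : Frontier F w n l p q x) (hn : hi ≤ n)
    (hF : F.Finite) (hw : NoNextBr w' F) (hl : ∀ i, i < lo ∨ hi < i → l' i = l i)
    (hb : ∀ i, l i ≤ NTM.blank M) (hl' : l' (n + 1) = NTM.blank M) :
    ∃ G x'', Relation.ReflTransGen (ChaseStep (SigmaM M qr)) F G ∧ G.Finite ∧
      NoNextBr w' G ∧ Frontier G w' (n + 1) l' p' q' x'' := by
  obtain ⟨G, x₁, s1, s2, s3, s4, s⟩ := hseg.extend_right (qr := qr) hfr hF hw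
    (fun i hi => hl i (Or.inr hi)) hb (n - hi) (by omega)
  rw [Nat.add_sub_cancel' hn] at s
  obtain ⟨H, x₂, t1, t2, t3, t4, t⟩ := Segment.extend_left (qr := qr) hfr le_rfl hb s3 s s2 s4
    fun i hi => hl i (Or.inl hi)
  have hp' := t.le_hi
  have fr := hfr.mono (s3.trans t3)
  obtain ⟨K, y, v1, v2, v3, v4, u1, u2, u3, u4⟩ := fire_end (qr := qr) t2 t4 t.right
    (t.next n (by omega) le_rfl) fr.fin (fr.brSet n le_rfl) (t.brSet n (by omega) le_rfl)
  have self : Function.update x₂ (n + 1) y (n + 1) = y := Function.update_self ..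
  have old : ∀ i, i ≤ n → Function.update x₂ (n + 1) y i = x₂ i :=
    fun i hi => Function.update_of_ne (by omega) ..
  have cases : ∀ {i}, i ≤ n + 1 → i ≤ n ∨ i = n + 1 := by omega
  refine ⟨K, Function.update x₂ (n + 1) y, (s1.trans t1).trans v1, v2, v4, ?_, ?_, ?_, ?_, ?_⟩
  · intro i h
    rcases cases (i := i + 1) (by omega) with h | h
    · rw [old i (by omega), old _ h]
      exact v3 (t.succ i (Nat.zero_le _) h)
    · obtain rfl : i = n := by omega
      rw [self, old _ le_rfl]
      exact u1
  · intro i h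
    rcases cases h with h | rfl
    · rw [old i h]
      exact v3 (t.letter i (Nat.zero_le _) h)
    · rw [self, hl']
      exact u2
  · intro i h
    rcases cases h with h | rfl
    · rw [old i h]
      exact fun f hf => v3 (t.brSet i (Nat.zero_le _) h f hf)
    · rw [self]
      exact u4
  · rw [old _ hp']
    exact v3 t.state
  · rw [self]
    exact u3

/-- The configuration `ρ` is represented in `F` under the brake `w`, and `w` has no successor. -/
def Represents (M : NTM) (F : Set Fact) (w : GroundTerm) (ρ : Config) : Prop :=
  F.Finite ∧ NoNextBr w F ∧
    ∃ x, Frontier F w ρ.1.length (fun i => ρ.1.getD i (NTM.blank M)) ρ.2.1 ρ.2.2 x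

theorem Represents.step {M : NTM} {qr : ℕ} {F : Set Fact} {w : GroundTerm} {ρ ρ' : Config}
    (h : Represents M F w ρ) (hstep : NTM.Next M ρ ρ') (hpos : ρ.2.1 < ρ.1.length)
    (hsym : ∀ a ∈ ρ.1, a ≤ NTM.blank M) :
    ∃ G w', Relation.ReflTransGen (ChaseStep (SigmaM M qr)) F G ∧ Represents M G w' ρ' ∧
      (ρ.2.2 ≠ qr → w' = w) ∧
      (ρ.2.2 = qr → w' ≠ w ∧ Relation.TransGen (ChaseStep (SigmaM M qr)) F G) := by
  obtain ⟨T, p, q⟩ := ρ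
  obtain ⟨q', b, d, he, hd, rfl⟩ := hstep
  obtain ⟨hF, hw, x, fr⟩ := h
  simp only at *
  have hb : ∀ i, T.getD i (NTM.blank M) ≤ NTM.blank M := by
    intro i
    by_cases hi : i < T.length
    · rw [List.getD_eq_getElem _ _ hi]
      exact hsym _ (List.getElem_mem hi)
    · rw [List.getD_eq_default _ _ (by omega)]
  have hp : T.getD p 0 = T.getD p (NTM.blank M) := by
    rw [List.getD_eq_getElem _ _ hpos, List.getD_eq_getElem _ _ hpos]
  rw [hp] at he
  have hlen : (T.set p b ++ [NTM.blank M]).length = T.length + 1 := by simp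
  have hl : ∀ i, (T.set p b ++ [NTM.blank M]).getD i (NTM.blank M) =
      if i = p then b else T.getD i (NTM.blank M) := by
    intro i
    rcases lt_or_ge i T.length with hi | hi
    · rw [List.getD_append _ _ _ _ (by simpa using hi), List.getD_eq_getElem _ _ (by simpa using hi),
        List.getD_eq_getElem _ _ hi, List.getElem_set]
      simp only [eq_comm]
    · rw [if_neg (by omega), List.getD_append_right _ _ _ _ (by simpa using hi),
        List.getD_eq_default _ _ hi]
      cases i - (T.set p b).length <;> simp
  generalize hl' : (fun i => (T.set p b ++ [NTM.blank M]).getD i (NTM.blank M)) = l'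
  have hl'p : l' p = b := by rw [← hl']; simp only [hl, if_true]
  have hl'n : ∀ i, i ≠ p → l' i = T.getD i (NTM.blank M) := by
    intro i hi; rw [← hl']; simp only [hl, if_neg hi]
  have hlast : l' (T.length + 1) = NTM.blank M := by
    rw [hl'n _ (by omega), List.getD_eq_default _ _ (by omega)]
  suffices hs : ∃ G w', Relation.ReflTransGen (ChaseStep (SigmaM M qr)) F G ∧ G.Finite ∧
      NoNextBr w' G ∧ (q ≠ qr → w' = w) ∧
      (q = qr → w' ≠ w ∧ Relation.TransGen (ChaseStep (SigmaM M qr)) F G) ∧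
      ∃ lo hi x', hi ≤ T.length ∧ F ⊆ G ∧ (∀ i, i < lo ∨ hi < i → i ≠ p) ∧
      Segment G w' lo hi l' (if d = true then p + 1 else p - 1) q' x x' by
    obtain ⟨G, w', s1, s2, s3, s4, s5, lo, hi, x', s6, s7, s8, seg⟩ := hs
    obtain ⟨H, x'', t1, t2, t3, t4⟩ := seg.complete (qr := qr) (fr.mono s7) s6 s2 s3
      (fun i hi => hl'n i (s8 i hi)) hb hlast
    refine ⟨H, w', s1.trans t1, ⟨t2, t3, x'', ?_⟩, s4, fun h => ⟨(s5 h).1, (s5 h).2.trans_left t1⟩⟩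
    simp only [hlen, hl']
    exact t4
  cases d with
  | true =>
    obtain ⟨G, w', x', y', s1, s2, s3, s4, s5, s6, u1, u2, u3, u4, u5, u6, u7, u8, u9, u10⟩ :=
      fire_transRight (qr := qr) he (hb (p + 1)) hF hw fr.state (fr.letter p hpos.le)
        (fr.succ p hpos) (fr.letter _ hpos) (fr.brSet p hpos.le) (fr.brSet _ hpos)
    refine ⟨G, w', s1, s2, s4, s5, s6, p, p + 1, fun i => if i = p then x' else y', hpos, s3,
      by omega, ?_⟩
    have cases : ∀ {i}, p ≤ i → i ≤ p + 1 → i = p ∨ i = p + 1 := by omega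
    refine ⟨by simp, by simp, ?_, ?_, ?_, ?_, ?_, ?_, ?_⟩
    · intro i h1 h2
      obtain rfl : i = p := by omega
      simpa using u4
    · intro i h1 h2
      rcases cases h1 h2 with rfl | rfl <;> simp [*]
    · intro i h1 h2
      rcases cases h1 h2 with rfl | rfl
      · simpa [hl'p] using u3
      · rw [hl'n _ (by omega)]
        simpa using u2
    · intro i h1 h2
      rcases cases h1 h2 with rfl | rfl
      · simpa using u9
      · simpa using u10
    · simpa using u1
    · simpa using u7
    · simpa using u8
  | false =>
    have hp1 : 1 ≤ p := by simpa using hd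
    obtain ⟨k, rfl⟩ : ∃ k, p = k + 1 := ⟨p - 1, by omega⟩
    obtain ⟨G, w', x', y', s1, s2, s3, s4, s5, s6, u1, u2, u3, u4, u5, u6, u7, u8, u9, u10⟩ :=
      fire_transLeft (qr := qr) he (hb k) hF hw fr.state (fr.letter _ hpos.le)
        (fr.succ k (by omega)) (fr.letter _ (by omega)) (fr.brSet _ hpos.le)
        (fr.brSet _ (by omega))
    refine ⟨G, w', s1, s2, s4, s5, s6, k, k + 1, fun i => if i = k then y' else x', hpos.le, s3,
      by omega, ?_⟩
    have cases : ∀ {i}, k ≤ i → i ≤ k + 1 → i = k ∨ i = k + 1 := by omega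
    refine ⟨by simp, by simp, ?_, ?_, ?_, ?_, ?_, ?_, ?_⟩
    · intro i h1 h2
      obtain rfl : i = k := by omega
      simpa using u4
    · intro i h1 h2
      rcases cases h1 h2 with rfl | rfl <;> simp [*]
    · intro i h1 h2
      rcases cases h1 h2 with rfl | rfl
      · rw [hl'n _ (by omega)]
        simpa using u2
      · simpa [hl'p] using u3
    · intro i h1 h2
      rcases cases h1 h2 with rfl | rfl
      · simpa using u10
      · simpa using u9
    · simpa using u1
    · simpa using u7
    · simpa using u8

theorem Represents.reach_visit {M : NTM} {qr : ℕ} {ρs : ℕ → Config}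
    (hstep : ∀ i, NTM.Next M (ρs i) (ρs (i + 1))) (hpos : ∀ i, (ρs i).2.1 < (ρs i).1.length)
    (hsym : ∀ i, ∀ a ∈ (ρs i).1, a ≤ NTM.blank M) (d : ℕ) :
    ∀ {i : ℕ} {F : Set Fact} {w : GroundTerm}, Represents M F w (ρs i) → (ρs (i + d)).2.2 = qr →
      ∃ G w' j, Relation.TransGen (ChaseStep (SigmaM M qr)) F G ∧ Represents M G w' (ρs j) ∧
        w' ≠ w := by
  induction d with
  | zero =>
    intro i F w h hq
    obtain ⟨G, w', -, s2, -, s4⟩ := h.step (qr := qr) (hstep i) (hpos i) (hsym i)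
    exact ⟨G, w', i + 1, (s4 hq).2, s2, (s4 hq).1⟩
  | succ d ih =>
    intro i F w h hq
    obtain ⟨G, w', s1, s2, s3, s4⟩ := h.step (qr := qr) (hstep i) (hpos i) (hsym i)
    by_cases hi : (ρs i).2.2 = qr
    · exact ⟨G, w', i + 1, (s4 hi).2, s2, (s4 hi).1⟩
    · obtain rfl := s3 hi
      obtain ⟨H, w'', j, t1, t2, t3⟩ := ih s2 (by rwa [Nat.add_right_comm, Nat.add_assoc])
      exact ⟨H, w'', j, t1.trans_right s1, t2, t3⟩

/-- Triggers for other brakes can be made obsolete without disturbing the simulation. -/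
theorem Represents.fire {M : NTM} {qr : ℕ} {F : Set Fact} {w : GroundTerm} {ρ : Config}
    (h : Represents M F w ρ) {t : Trigger} (ht : t.1 ∈ SigmaM M qr) (hne : t.2 4 ≠ w) :
    ∃ G, Relation.ReflTransGen (ChaseStep (SigmaM M qr)) F G ∧ Represents M G w ρ ∧
      (loaded t F → obsolete t G) := by
  by_cases hl : loaded t F
  · obtain ⟨hF, hw, x, fr⟩ := h
    obtain ⟨G, σ, s1, s2, s3, s4, s5, s6⟩ := exists_fire hF ht hl
    exact ⟨G, s1, ⟨s2, fun g hg => hw.of_trigger ht s4 hne g (s6 hg), x, fr.mono s3⟩,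
      fun _ => ⟨σ, s4, s5⟩⟩
  · exact ⟨F, .refl, h, fun h' => absurd h' hl⟩

theorem transGen_chaseStep_subset {S : RuleSet} {F G : Set Fact}
    (h : Relation.TransGen (ChaseStep S) F G) : F ⊆ G := by
  induction h with
  | single h => exact h.subset
  | tail _ h ih => exact ih.trans h.subset

theorem represents_start (M : NTM) :
    Represents M (dbSet (Drho M (startConfig M []))) w1 (startConfig M []) := by
  refine ⟨List.finite_toSet _, ?_, cst, ?_⟩
  · intro g
    simp [dbSet, Drho, startConfig, brSetF, List.range_succ, ne_pNextBr,
      eq_comm (a := pNextBr)]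
  · constructor
    · simp [dbSet, Drho, startConfig]
    · intro i hi
      have : i = 0 ∨ i = 1 := by simp [startConfig] at hi; omega
      rcases this with rfl | rfl <;> simp [dbSet, Drho, startConfig]
    · intro i hi f hf
      have : i = 0 ∨ i = 1 := by simp [startConfig] at hi; omega
      rcases this with rfl | rfl <;>
        simp [dbSet, Drho, startConfig, List.range_succ, hf]
    · simp [dbSet, Drho, startConfig]
    · simp [dbSet, Drho, startConfig]

/-- If `(ρs i)_{i ∈ ℕ}` is a run of the machine `M` on the empty word that
visits the designated state `q_r` infinitely often, then there exists an infinite (fair)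
restricted chase sequence for the knowledge base `⟨Σ_M, D_ε⟩` (where `D_ε` encodes the starting
configuration of `M` on the empty word). -/
theorem recurring_run_gives_infinite_chase (M : NTM) (qr : ℕ)
    (hM : NTM.WF M) (hqr : qr < NTM.numStates M)
    (ρs : ℕ → Config) (h0 : ρs 0 = startConfig M [])
    (hstep : ∀ i : ℕ, NTM.Next M (ρs i) (ρs (i + 1)))
    (hrec : ∀ N : ℕ, ∃ i : ℕ, N ≤ i ∧ (ρs i).2.2 = qr) :
    ∃ c : Chase (SigmaM M qr) (dbSet (Drho M (startConfig M []))),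
      IsInfinite c ∧ Fair c := by
  have hinv : ∀ i, (ρs i).2.1 < (ρs i).1.length ∧ ∀ a ∈ (ρs i).1, a ≤ NTM.blank M := by
    intro i
    induction i with
    | zero => simp [h0, startConfig]
    | succ i ih =>
      obtain ⟨q', b, d, he, -, heq⟩ := hstep i
      have hb := (hM.2.2 _ he).2.2.2
      rw [heq]
      refine ⟨?_, ?_⟩
      · simp only [List.length_append, List.length_set, List.length_singleton]
        split_ifs <;> omega
      · intro a ha
        rcases List.mem_append.1 ha with ha | ha
        · rcases List.mem_or_eq_of_mem_set ha with ha | rfl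
          · exact ih.2 a ha
          · exact hb.le
        · simp at ha
          exact ha.le
  have hnew : ∀ {i F w}, Represents M F w (ρs i) →
      ∃ G w' j, Relation.TransGen (ChaseStep (SigmaM M qr)) F G ∧ Represents M G w' (ρs j) ∧
        w' ≠ w := by
    intro i F w h
    obtain ⟨k, hk, hq⟩ := hrec i
    exact h.reach_visit hstep (fun i => (hinv i).1) (fun i => (hinv i).2) (k - i)
      (by rwa [Nat.add_sub_cancel' hk])
  refine exists_infinite_fair_chase (fun F => ∃ i w, Represents M F w (ρs i))
    ⟨_, ruleEnd_mem⟩ ⟨0, w1, h0 ▸ represents_start M⟩ ?_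
  rintro F ⟨i, w, h⟩ t ht
  obtain ⟨G, w', j, hFG, hG, -⟩ := hnew h
  obtain ⟨H, v, k, hFH, hH, hne⟩ : ∃ H v k, Relation.TransGen (ChaseStep (SigmaM M qr)) F H ∧
      Represents M H v (ρs k) ∧ t.2 4 ≠ v := by
    by_cases hw' : t.2 4 = w'
    · obtain ⟨H, v, k, hGH, hH, hne⟩ := hnew hG
      exact ⟨H, v, k, hFG.trans hGH, hH, hw' ▸ hne.symm⟩
    · exact ⟨G, w', j, hFG, hG, hw'⟩
  obtain ⟨K, hHK, hK, ho⟩ := hH.fire ht hne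
  exact ⟨K, hFH.trans_left hHK, ⟨k, v, hK⟩,
    fun hl => ho (loaded_mono (transGen_chaseStep_subset hFH) hl)⟩

end ChaseTermination
end
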